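/- arXiv:1908.01967 — 3 statements merged into one kernel-verified Lean document; each statement's English description precedes it below -/
import Mathlib

section
/- Let f : U → 𝕃³ be a smooth immersion on an open neighborhood U of (0,0) ∈ ℝ² with ⟨f_u, f_v⟩ ≡ 0, E := ⟨f_u, f_u⟩ > 0, E(u,0) = 1 for all u, and put λ := E·G where G := ⟨f_v, f_v⟩. Assume λ(0,0) = 0, dλ(0,0) ≠ 0, λ(u,0) ≠ 0 for all u ≠ 0 with (u,0) ∈ U, and E_v(0,0) ≠ 0 (so (0,0) is a generic lightlike point of the second kind and the u-axis is a non-null curve through it, in L-coordinates associated with that curve). Let ψ : U → ℝ³ be an L-Gauss map of f, and set ĉ(u) := f(u,0), x(u) := ⟨f_uu, ψ⟩(u,0), θ(u) := ⟨ĉ''(u), ĉ''(u)⟩. Then: (i) ⟨ĉ'(u), ĉ'(u)⟩ = 1 and ĉ''(0) ≠ 0; (ii) λ(u,0)·x(u)² + E_v(u,0)·x(u) + θ(u) = 0 for all u with (u,0) ∈ U; (iii) for u near 0, x(u) = −2θ(u)/(E_v(u,0) + sgn(E_v(0,0))·√(E_v(u,0)² − 4λ(u,0)θ(u))). -/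
noncomputable section

/-- The Minkowski inner product of signature (+,+,−) on ℝ³. -/
def mink (x y : Fin 3 → ℝ) : ℝ := x 0 * y 0 + x 1 * y 1 - x 2 * y 2

/-- The Lorentzian vector product `v × w = S (v ×ₑ w)`, `S = diag(1,1,−1)`. -/
def lcross (v w : Fin 3 → ℝ) : Fin 3 → ℝ :=
  ![v 1 * w 2 - v 2 * w 1, v 2 * w 0 - v 0 * w 2, -(v 0 * w 1 - v 1 * w 0)]

/-- Partial derivative in the first coordinate direction. -/
def pu {E : Type*} [NormedAddCommGroup E] [NormedSpace ℝ E]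
    (f : ℝ × ℝ → E) (q : ℝ × ℝ) : E :=
  fderiv ℝ f q (1, 0)

/-- Partial derivative in the second coordinate direction. -/
def pv {E : Type*} [NormedAddCommGroup E] [NormedSpace ℝ E]
    (f : ℝ × ℝ → E) (q : ℝ × ℝ) : E :=
  fderiv ℝ f q (0, 1)

theorem fderiv_mink_apply {a b : ℝ × ℝ → Fin 3 → ℝ} {q : ℝ × ℝ}
    (ha : DifferentiableAt ℝ a q) (hb : DifferentiableAt ℝ b q) (w : ℝ × ℝ) :
    fderiv ℝ (fun p => mink (a p) (b p)) q w
      = mink (fderiv ℝ a q w) (b q) + mink (a q) (fderiv ℝ b q w) := by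
  have ha' := fun i => hasFDerivAt_pi'.1 ha.hasFDerivAt i
  have hb' := fun i => hasFDerivAt_pi'.1 hb.hasFDerivAt i
  have h := (((ha' 0).mul (hb' 0)).add ((ha' 1).mul (hb' 1))).sub ((ha' 2).mul (hb' 2))
  have h' : fderiv ℝ (fun p => mink (a p) (b p)) q = _ := HasFDerivAt.fderiv h
  rw [h']
  simp [mink]
  ring

theorem mink_comm (v w : Fin 3 → ℝ) : mink v w = mink w v := by
  simp only [mink]; ring

theorem contDiffAt_mink {a b : ℝ × ℝ → Fin 3 → ℝ} {q : ℝ × ℝ} {n : WithTop ℕ∞}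
    (ha : ContDiffAt ℝ n a q) (hb : ContDiffAt ℝ n b q) :
    ContDiffAt ℝ n (fun p => mink (a p) (b p)) q := by
  have ha' := contDiffAt_pi.1 ha
  have hb' := contDiffAt_pi.1 hb
  exact (((ha' 0).mul (hb' 0)).add ((ha' 1).mul (hb' 1))).sub ((ha' 2).mul (hb' 2))

theorem contDiffAt_fderiv_apply {F : Type*} [NormedAddCommGroup F] [NormedSpace ℝ F]
    {g : ℝ × ℝ → F} {q : ℝ × ℝ} (hg : ContDiffAt ℝ (⊤ : ℕ∞) g q) (w : ℝ × ℝ) :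
    ContDiffAt ℝ (⊤ : ℕ∞) (fun p => fderiv ℝ g p w) q :=
  (hg.fderiv_right (m := (⊤ : ℕ∞)) (by simp)).clm_apply contDiffAt_const

theorem pu_pv_comm {F : Type*} [NormedAddCommGroup F] [NormedSpace ℝ F]
    {g : ℝ × ℝ → F} {q : ℝ × ℝ} (hg : ContDiffAt ℝ (⊤ : ℕ∞) g q) :
    pu (pv g) q = pv (pu g) q := by
  have hd : DifferentiableAt ℝ (fderiv ℝ g) q :=
    (hg.fderiv_right (m := (⊤ : ℕ∞)) (by simp)).differentiableAt (by simp)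
  have key : ∀ v w : ℝ × ℝ, fderiv ℝ (fun p => fderiv ℝ g p v) q w
      = fderiv ℝ (fderiv ℝ g) q w v := by
    intro v w
    rw [fderiv_clm_apply hd (differentiableAt_const v)]
    simp
  have hs : IsSymmSndFDerivAt ℝ g q := hg.isSymmSndFDerivAt (by
    simp only [minSmoothness_of_isRCLikeNormedField]
    exact WithTop.coe_le_coe.2 le_top)
  have h1 := key (0, 1) (1, 0)
  have h2 := key (1, 0) (0, 1)
  exact h1.trans ((hs.eq _ _).trans h2.symm)

theorem deriv_comp_axis {F : Type*} [NormedAddCommGroup F] [NormedSpace ℝ F]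
    {g : ℝ × ℝ → F} {u : ℝ} (hg : DifferentiableAt ℝ g (u, 0)) :
    deriv (fun t : ℝ => g (t, 0)) u = pu g (u, 0) := by
  have h : HasDerivAt (fun t : ℝ => ((t, 0) : ℝ × ℝ)) (1, 0) u :=
    (hasDerivAt_id u).prodMk (hasDerivAt_const u 0)
  exact (hg.hasFDerivAt.comp_hasDerivAt u h).deriv

/-- A vector orthogonal to the first vector of a frame `a, b, p` with `a` orthogonal to `b` and
`p`, `p` null and `⟨b, p⟩ = 1` has its norm determined by its products with `b` and `p`. -/
theorem mink_self_of_frame {a b p w : Fin 3 → ℝ} (haa : mink a a = 1) (hab : mink a b = 0)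
    (hpp : mink p p = 0) (hpa : mink p a = 0) (hpb : mink p b = 1) (hwa : mink w a = 0) :
    mink w w = 2 * mink w p * mink w b - mink b b * mink w p ^ 2 := by
  simp only [mink] at *
  set y := w 0 * p 0 + w 1 * p 1 - w 2 * p 2 with hy
  set z := w 0 * b 0 + w 1 * b 1 - w 2 * b 2 with hz
  set g := b 0 * b 0 + b 1 * b 1 - b 2 * b 2 with hg
  obtain ⟨r, hr⟩ : ∃ r : Fin 3 → ℝ, ∀ i, r i = w i - y * b i - (z - y * g) * p i :=
    ⟨fun i => w i - y * b i - (z - y * g) * p i, fun _ => rfl⟩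
  have ra : r 0 * a 0 + r 1 * a 1 - r 2 * a 2 = 0 := by
    simp only [hr]; linear_combination hwa - y * hab - (z - y * g) * hpa
  have rb : r 0 * b 0 + r 1 * b 1 - r 2 * b 2 = 0 := by
    simp only [hr]; linear_combination -hz + y * hg - (z - y * g) * hpb
  have rp : r 0 * p 0 + r 1 * p 1 - r 2 * p 2 = 0 := by
    simp only [hr]; linear_combination -hy - y * hpb - (z - y * g) * hpp
  let D := a 0 * (b 1 * p 2 - b 2 * p 1) - a 1 * (b 0 * p 2 - b 2 * p 0)
    + a 2 * (b 0 * p 1 - b 1 * p 0)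
  have hD : D ^ 2 = 1 := by
    have gram : D ^ 2 = -(Matrix.det
        !![a 0 * a 0 + a 1 * a 1 - a 2 * a 2, a 0 * b 0 + a 1 * b 1 - a 2 * b 2,
            p 0 * a 0 + p 1 * a 1 - p 2 * a 2;
          a 0 * b 0 + a 1 * b 1 - a 2 * b 2, b 0 * b 0 + b 1 * b 1 - b 2 * b 2,
            p 0 * b 0 + p 1 * b 1 - p 2 * b 2;
          p 0 * a 0 + p 1 * a 1 - p 2 * a 2, p 0 * b 0 + p 1 * b 1 - p 2 * b 2,
            p 0 * p 0 + p 1 * p 1 - p 2 * p 2]) := by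
      simp only [D, Matrix.det_fin_three, Matrix.of_apply, Matrix.cons_val', Matrix.cons_val]
      ring
    rw [gram, haa, hab, hpp, hpa, hpb]
    simp [Matrix.det_fin_three]
  have hD0 : D ≠ 0 := by rintro h; rw [h] at hD; norm_num at hD
  have r0 : r 0 = 0 := by
    have : D * r 0 = 0 := by
      simp only [D]
      linear_combination (b 1 * p 2 - b 2 * p 1) * ra - (a 1 * p 2 - a 2 * p 1) * rb
        + (a 1 * b 2 - a 2 * b 1) * rp
    exact (mul_eq_zero.1 this).resolve_left hD0
  have r1 : r 1 = 0 := by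
    have : D * r 1 = 0 := by
      simp only [D]
      linear_combination -(b 0 * p 2 - b 2 * p 0) * ra + (a 0 * p 2 - a 2 * p 0) * rb
        - (a 0 * b 2 - a 2 * b 0) * rp
    exact (mul_eq_zero.1 this).resolve_left hD0
  have r2 : r 2 = 0 := by
    have : D * r 2 = 0 := by
      simp only [D]
      linear_combination -(b 0 * p 1 - b 1 * p 0) * ra + (a 0 * p 1 - a 1 * p 0) * rb
        - (a 0 * b 1 - a 1 * b 0) * rp
    exact (mul_eq_zero.1 this).resolve_left hD0
  rw [hr] at r0 r1 r2
  linear_combination w 0 * r0 + w 1 * r1 - w 2 * r2 - y * hz - (z - y * g) * hy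

/-- The root of `l x² + e x + t` that stays bounded as `l → 0`, in rationalized form. -/
theorem eq_neg_two_mul_div_of_quadratic {l e t x s : ℝ} (hs : s = 1 ∨ s = -1)
    (h : l * x ^ 2 + e * x + t = 0) (h1 : 0 < s * (2 * l * x + e)) (h2 : 0 < s * (l * x + e)) :
    x = -(2 * t) / (e + s * √(e ^ 2 - 4 * l * t)) := by
  have hd : e ^ 2 - 4 * l * t = (s * (2 * l * x + e)) ^ 2 := by
    rcases hs with rfl | rfl <;> linear_combination -4 * l * h
  have hss : s * s = 1 := by rcases hs with rfl | rfl <;> norm_num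
  rw [hd, Real.sqrt_sq h1.le, ← mul_assoc, hss]
  have : e + 1 * (2 * l * x + e) ≠ 0 := by
    intro h0
    have : l * x + e = 0 := by linarith
    simp [this] at h2
  rw [eq_div_iff this]
  linear_combination 2 * h

/-- At a generic lightlike point of the second kind, in
L-coordinates associated with a non-null curve (the `u`-axis), the curve
`ĉ(u) = f(u,0)` is unit-speed spacelike with `ĉ''(0) ≠ 0`, the coefficient
`x = ⟨f_uu, ψ⟩` satisfies `λ·x² + E_v·x + θ = 0` along the `u`-axis, and near
`u = 0`, `x = −2θ/(E_v + sgn(E_v(0,0))·√(E_v² − 4λθ))`. -/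
theorem invariants_second_kind
    (U : Set (ℝ × ℝ)) (hU : IsOpen U) (h00 : (0, 0) ∈ U)
    (f : ℝ × ℝ → Fin 3 → ℝ) (hf : ContDiffOn ℝ (⊤ : ℕ∞) f U)
    (himm : ∀ q ∈ U, LinearIndependent ℝ ![pu f q, pv f q])
    (E G lam : ℝ × ℝ → ℝ)
    (hE : E = fun q => mink (pu f q) (pu f q))
    (hG : G = fun q => mink (pv f q) (pv f q))
    (hFzero : ∀ q ∈ U, mink (pu f q) (pv f q) = 0)
    (hEpos : ∀ q ∈ U, 0 < E q)
    (hE1 : ∀ u : ℝ, (u, 0) ∈ U → E (u, 0) = 1)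
    (hlam : lam = fun q => E q * G q)
    (hlam0 : lam (0, 0) = 0)
    (hdlam : fderiv ℝ lam (0, 0) ≠ 0)
    (hlamaxis : ∀ u : ℝ, u ≠ 0 → (u, 0) ∈ U → lam (u, 0) ≠ 0)
    (hEv : pv E (0, 0) ≠ 0)
    (ε : ℝ) (hε : ε = 1 ∨ ε = -1)
    (ψ : ℝ × ℝ → Fin 3 → ℝ) (hψ : ContDiffOn ℝ (⊤ : ℕ∞) ψ U)
    (hLG : ∀ q ∈ U, lcross (pu f q) (pv f q)
      = (ε * Real.sqrt (E q)) • (pv f q - G q • ψ q))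
    (hψψ : ∀ q ∈ U, mink (ψ q) (ψ q) = 0)
    (hψu : ∀ q ∈ U, mink (ψ q) (pu f q) = 0)
    (hψv : ∀ q ∈ U, mink (ψ q) (pv f q) = 1)
    (c : ℝ → Fin 3 → ℝ) (hc : c = fun u => f (u, 0))
    (x θ : ℝ → ℝ)
    (hx : x = fun u => mink (pu (pu f) (u, 0)) (ψ (u, 0)))
    (hθ : θ = fun u => mink (deriv (deriv c) u) (deriv (deriv c) u)) :
    -- (i) unit-speed, with nonvanishing curvature vector at the origin
    (∀ u : ℝ, (u, 0) ∈ U → mink (deriv c u) (deriv c u) = 1) ∧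
    deriv (deriv c) 0 ≠ 0 ∧
    -- (ii) the quadratic relation along the u-axis
    (∀ u : ℝ, (u, 0) ∈ U →
      lam (u, 0) * (x u) ^ 2 + pv E (u, 0) * x u + θ u = 0) ∧
    -- (iii) the formula for x near u = 0
    (∃ ε' > 0, ∀ u ∈ Set.Ioo (-ε') ε', (u, 0) ∈ U ∧
      x u = -(2 * θ u) /
        (pv E (u, 0) + Real.sign (pv E (0, 0)) *
          Real.sqrt ((pv E (u, 0)) ^ 2 - 4 * lam (u, 0) * θ u))) := by
  have hfU : ∀ q ∈ U, ContDiffAt ℝ (⊤ : ℕ∞) f q := fun q hq => hf.contDiffAt (hU.mem_nhds hq)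
  have hpu : ∀ q ∈ U, ContDiffAt ℝ (⊤ : ℕ∞) (pu f) q :=
    fun q hq => contDiffAt_fderiv_apply (hfU q hq) _
  have hpv : ∀ q ∈ U, ContDiffAt ℝ (⊤ : ℕ∞) (pv f) q :=
    fun q hq => contDiffAt_fderiv_apply (hfU q hq) _
  have dpu : ∀ q ∈ U, DifferentiableAt ℝ (pu f) q :=
    fun q hq => (hpu q hq).differentiableAt (by simp)
  have dpv : ∀ q ∈ U, DifferentiableAt ℝ (pv f) q :=
    fun q hq => (hpv q hq).differentiableAt (by simp)
  have haxis : Continuous fun u : ℝ => ((u, 0) : ℝ × ℝ) := by fun_prop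
  have hnhds : ∀ u : ℝ, (u, 0) ∈ U → ∀ᶠ t : ℝ in nhds u, (t, 0) ∈ U := fun u hu =>
    haxis.continuousAt.eventually (hU.mem_nhds hu)
  have hc1 : ∀ u : ℝ, (u, 0) ∈ U → deriv c u = pu f (u, 0) := by
    intro u hu
    rw [hc]
    exact deriv_comp_axis ((hfU _ hu).differentiableAt (by simp))
  have hc2 : ∀ u : ℝ, (u, 0) ∈ U → deriv (deriv c) u = pu (pu f) (u, 0) := by
    intro u hu
    have h : deriv c =ᶠ[nhds u] fun t => pu f (t, 0) := (hnhds u hu).mono hc1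
    rw [h.deriv_eq]
    exact deriv_comp_axis (dpu _ hu)
  have hEvv : ∀ q ∈ U, pv E q = 2 * mink (pu f q) (pv (pu f) q) := by
    intro q hq
    have h := fderiv_mink_apply (dpu q hq) (dpu q hq) (0, 1)
    rw [mink_comm (fderiv ℝ (pu f) q (0, 1))] at h
    rw [hE]
    exact h.trans (two_mul _).symm
  have hfuv : ∀ q ∈ U, mink (pu (pu f) q) (pv f q) = -(pv E q) / 2 := by
    intro q hq
    have h := fderiv_mink_apply (dpu q hq) (dpv q hq) (1, 0)
    have h0 : (fun p => mink (pu f p) (pv f p)) =ᶠ[nhds q] fun _ => 0 :=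
      (hU.mem_nhds hq |> Filter.eventually_of_mem) hFzero
    rw [h0.fderiv_eq] at h
    change _ = mink (pu (pu f) q) (pv f q) + mink (pu f q) (pu (pv f) q) at h
    rw [pu_pv_comm (hfU q hq)] at h
    simp at h
    linarith [hEvv q hq]
  have hfuu : ∀ u : ℝ, (u, 0) ∈ U → mink (pu (pu f) (u, 0)) (pu f (u, 0)) = 0 := by
    intro u hu
    have h := fderiv_mink_apply (dpu _ hu) (dpu _ hu) (1, 0)
    have hd := deriv_comp_axis (g := E) (u := u) (by
      rw [hE]
      exact (contDiffAt_mink (hpu _ hu) (hpu _ hu)).differentiableAt (by simp))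
    have h0 : (fun t : ℝ => E (t, 0)) =ᶠ[nhds u] fun _ => 1 := (hnhds u hu).mono hE1
    rw [h0.deriv_eq, deriv_const, hE] at hd
    have h3 := hd.trans h
    rw [mink_comm (pu f (u, 0))] at h3
    change 0 = mink (pu (pu f) (u, 0)) (pu f (u, 0)) + mink (pu (pu f) (u, 0)) (pu f (u, 0)) at h3
    linarith
  have hquad : ∀ u : ℝ, (u, 0) ∈ U →
      lam (u, 0) * (x u) ^ 2 + pv E (u, 0) * x u + θ u = 0 := by
    intro u hu
    have h1 : mink (pu f (u, 0)) (pu f (u, 0)) = 1 := by simpa [hE] using hE1 u hu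
    have h := mink_self_of_frame h1 (hFzero _ hu) (hψψ _ hu) (hψu _ hu) (hψv _ hu) (hfuu u hu)
    rw [hfuv _ hu] at h
    have hl : lam (u, 0) = mink (pv f (u, 0)) (pv f (u, 0)) := by
      simp only [hlam, hE1 u hu, hG, one_mul]
    simp only [hθ, hc2 u hu, hl, hx]
    linear_combination h
  refine ⟨fun u hu => ?_, fun h => hEv ?_, hquad, ?_⟩
  · rw [hc1 u hu]
    simpa [hE] using hE1 u hu
  · have h' := hfuv _ h00
    rw [← hc2 0 h00, h] at h'
    simp only [mink, Pi.zero_apply, zero_mul, add_zero, sub_zero] at h'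
    linarith
  · have hEc : ContDiffAt ℝ (⊤ : ℕ∞) E (0, 0) := by
      rw [hE]; exact contDiffAt_mink (hpu _ h00) (hpu _ h00)
    have hGc : ContDiffAt ℝ (⊤ : ℕ∞) G (0, 0) := by
      rw [hG]; exact contDiffAt_mink (hpv _ h00) (hpv _ h00)
    have cl : ContinuousAt (fun u : ℝ => lam (u, 0)) 0 := by
      rw [hlam]
      exact ContinuousAt.comp (f := fun u : ℝ => ((u, 0) : ℝ × ℝ)) (hEc.mul hGc).continuousAt
        haxis.continuousAt
    have ce : ContinuousAt (fun u : ℝ => pv E (u, 0)) 0 :=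
      ContinuousAt.comp (f := fun u : ℝ => ((u, 0) : ℝ × ℝ))
        (contDiffAt_fderiv_apply hEc (0, 1)).continuousAt haxis.continuousAt
    have cx : ContinuousAt x 0 := by
      rw [hx]
      exact ContinuousAt.comp (f := fun u : ℝ => ((u, 0) : ℝ × ℝ))
        (contDiffAt_mink (contDiffAt_fderiv_apply (hpu _ h00) (1, 0))
          (hψ.contDiffAt (hU.mem_nhds h00))).continuousAt haxis.continuousAt
    set s := Real.sign (pv E (0, 0))
    have hs : s = 1 ∨ s = -1 := (Real.sign_apply_eq_of_ne_zero _ hEv).symm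
    have hpos : 0 < s * pv E (0, 0) := Real.sign_mul_pos_of_ne_zero _ hEv
    have e1 : ∀ᶠ u in nhds (0 : ℝ), 0 < s * (2 * lam (u, 0) * x u + pv E (u, 0)) :=
      (continuousAt_const.mul (((continuousAt_const.mul cl).mul cx).add ce)).eventually_const_lt
        (by simpa [hlam0] using hpos)
    have e2 : ∀ᶠ u in nhds (0 : ℝ), 0 < s * (lam (u, 0) * x u + pv E (u, 0)) :=
      (continuousAt_const.mul ((cl.mul cx).add ce)).eventually_const_lt
        (by simpa [hlam0] using hpos)
    obtain ⟨δ, hδ, h⟩ := Metric.eventually_nhds_iff.1 ((hnhds 0 h00).and (e1.and e2))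
    refine ⟨δ, hδ, fun u hu => ?_⟩
    obtain ⟨hu1, hu2, hu3⟩ := h (y := u) (by simpa [abs_lt] using hu)
    exact ⟨hu1, eq_neg_two_mul_div_of_quadratic hs (hquad u hu1) hu2 hu3⟩
end
end

section
/- Uniqueness of unit-speed spacelike Frenet curves in 𝕃³: Let I ⊆ ℝ be an open interval containing 0 and let γ, γ̄ : I → 𝕃³ be smooth curves with ⟨γ', γ'⟩ = ⟨γ̄', γ̄'⟩ = 1 on I, and suppose the causal curvature functions θ := ⟨γ'', γ''⟩ and θ̄ := ⟨γ̄'', γ̄''⟩ vanish nowhere on I. Define τ := −det(γ', γ'', γ''')/θ, n := γ''/√|θ|, b := σ·(γ' × n) with σ := −1 if θ > 0 and σ := 1 if θ < 0, and define τ̄, n̄, b̄ similarly. If γ(0) = γ̄(0), θ(u) = θ̄(u) and τ(u) = τ̄(u) for all u ∈ I, and (γ'(0), n(0), b(0)) = (γ̄'(0), n̄(0), b̄(0)), then γ(u) = γ̄(u) for all u ∈ I. -/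
noncomputable section

theorem HasDerivAt.mink {f g : ℝ → Fin 3 → ℝ} {f' g' : Fin 3 → ℝ} {u : ℝ}
    (hf : HasDerivAt f f' u) (hg : HasDerivAt g g' u) :
    HasDerivAt (fun u => mink (f u) (g u)) (mink f' (g u) + mink (f u) g') u := by
  rw [hasDerivAt_pi] at hf hg
  refine ((((hf 0).mul (hg 0)).add ((hf 1).mul (hg 1))).sub ((hf 2).mul (hg 2))).congr_deriv ?_
  simp only [_root_.mink]
  ring

theorem HasDerivAt.lcross {f g : ℝ → Fin 3 → ℝ} {f' g' : Fin 3 → ℝ} {u : ℝ}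
    (hf : HasDerivAt f f' u) (hg : HasDerivAt g g' u) :
    HasDerivAt (fun u => lcross (f u) (g u)) (lcross f' (g u) + lcross (f u) g') u := by
  rw [hasDerivAt_pi] at hf hg ⊢
  intro i
  fin_cases i
  · refine (((hf 1).mul (hg 2)).sub ((hf 2).mul (hg 1))).congr_deriv ?_
    simp [_root_.lcross]
    ring
  · refine (((hf 2).mul (hg 0)).sub ((hf 0).mul (hg 2))).congr_deriv ?_
    simp [_root_.lcross]
    ring
  · refine (((hf 0).mul (hg 1)).sub ((hf 1).mul (hg 0))).neg.congr_deriv ?_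
    simp [_root_.lcross]
    ring

theorem mink_comm_s15 (x y : Fin 3 → ℝ) : mink x y = mink y x := by
  simp only [mink]
  ring

theorem mink_lcross_left (v w : Fin 3 → ℝ) : mink (lcross v w) v = 0 := by
  simp [mink, lcross]
  ring

theorem mink_lcross_right (v w : Fin 3 → ℝ) : mink (lcross v w) w = 0 := by
  simp [mink, lcross]
  ring

theorem mink_lcross_eq_det (v w x : Fin 3 → ℝ) :
    mink (lcross v w) x = Matrix.det (Matrix.of ![v, w, x]) := by
  simp [mink, lcross, Matrix.det_fin_three]
  ring

theorem lcross_lcross_self (v w : Fin 3 → ℝ) :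
    lcross v (lcross v w) = mink v v • w - mink v w • v := by
  ext i
  fin_cases i <;> simp [mink, lcross] <;> ring

/-- Expansion of a vector in the frame `v, w, v × w`, with denominators cleared. -/
theorem gram_smul_eq (v w x : Fin 3 → ℝ) :
    (mink v v * mink w w - mink v w ^ 2) • x =
      (mink x v * mink w w - mink x w * mink v w) • v +
      (mink x w * mink v v - mink x v * mink v w) • w -
      mink (lcross v w) x • lcross v w := by
  ext i
  fin_cases i <;> simp [mink, lcross] <;> ring

/-- The Frenet equations on `s`, written for the tangent field `e` and its derivative `p`,
with `⟨p, p⟩ = θ`, `θ' = β` and torsion `τ`. -/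
structure IsFrenetSystem (s : Set ℝ) (θ β τ : ℝ → ℝ) (e p : ℝ → Fin 3 → ℝ) : Prop where
  mink_e_e : ∀ u ∈ s, mink (e u) (e u) = 1
  mink_e_p : ∀ u ∈ s, mink (e u) (p u) = 0
  hasDerivAt_e : ∀ u ∈ s, HasDerivAt e (p u) u
  hasDerivAt_p : ∀ u ∈ s, HasDerivAt p
    (-θ u • e u + (β u / (2 * θ u)) • p u + τ u • lcross (e u) (p u)) u

/-- The `(i, j)` entry of the tensor `e ⊗ e₁ + (p ⊗ p₁ - (e × p) ⊗ (e₁ × p₁)) / θ`. -/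
def frameTensor (θ : ℝ) (e p e₁ p₁ : Fin 3 → ℝ) (i j : Fin 3) : ℝ :=
  e i * e₁ j + (p i * p₁ j - lcross e p i * lcross e₁ p₁ j) / θ

namespace IsFrenetSystem

variable {s : Set ℝ} {θ β τ : ℝ → ℝ} {e p e₁ p₁ : ℝ → Fin 3 → ℝ}

theorem hasDerivAt_lcross (h : IsFrenetSystem s θ β τ e p) {u : ℝ} (hu : u ∈ s) :
    HasDerivAt (fun u => lcross (e u) (p u))
      ((β u / (2 * θ u)) • lcross (e u) (p u) + τ u • p u) u := by
  refine ((h.hasDerivAt_e u hu).lcross (h.hasDerivAt_p u hu)).congr_deriv ?_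
  have hc : lcross (e u) (lcross (e u) (p u)) = p u := by
    rw [lcross_lcross_self, h.mink_e_e u hu, h.mink_e_p u hu]
    simp
  calc
    _ = (β u / (2 * θ u)) • lcross (e u) (p u) + τ u • lcross (e u) (lcross (e u) (p u)) := by
      ext i
      fin_cases i <;> simp [lcross] <;> ring
    _ = _ := by rw [hc]

theorem hasDerivAt_frameTensor (h : IsFrenetSystem s θ β τ e p)
    (h₁ : IsFrenetSystem s θ β τ e₁ p₁) {u : ℝ} (hu : u ∈ s) (hθ : HasDerivAt θ (β u) u)
    (h0 : θ u ≠ 0) (i j : Fin 3) :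
    HasDerivAt (fun u => frameTensor (θ u) (e u) (p u) (e₁ u) (p₁ u) i j) 0 u := by
  have he := hasDerivAt_pi.1 (h.hasDerivAt_e u hu) i
  have hp := hasDerivAt_pi.1 (h.hasDerivAt_p u hu) i
  have hc := hasDerivAt_pi.1 (h.hasDerivAt_lcross hu) i
  have he₁ := hasDerivAt_pi.1 (h₁.hasDerivAt_e u hu) j
  have hp₁ := hasDerivAt_pi.1 (h₁.hasDerivAt_p u hu) j
  have hc₁ := hasDerivAt_pi.1 (h₁.hasDerivAt_lcross hu) j
  refine ((he.mul he₁).add (((hp.mul hp₁).sub (hc.mul hc₁)).div hθ h0)).congr_deriv ?_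
  simp only [Pi.add_apply, Pi.smul_apply, smul_eq_mul, Pi.mul_apply, Pi.sub_apply]
  field_simp
  ring

theorem frameTensor_contract (h₁ : IsFrenetSystem s θ β τ e₁ p₁) {u : ℝ} (hu : u ∈ s)
    (v w : Fin 3 → ℝ) (i : Fin 3) :
    mink (frameTensor (θ u) v w (e₁ u) (p₁ u) i) (e₁ u) = v i := by
  have h1 := h₁.mink_e_e u hu
  have h2 := h₁.mink_e_p u hu
  have h3 := mink_lcross_left (e₁ u) (p₁ u)
  simp only [mink] at h1 h2 h3
  simp only [mink, frameTensor]
  linear_combination v i * h1 + w i / θ u * h2 - lcross v w i / θ u * h3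

/-- Two solutions of the same Frenet equations which agree at one point have the same tangent. -/
theorem eqOn (hs : IsOpen s) (hs' : IsPreconnected s)
    (h : IsFrenetSystem s θ β τ e p) (h₁ : IsFrenetSystem s θ β τ e₁ p₁)
    (hθ : ∀ u ∈ s, HasDerivAt θ (β u) u) (h0 : ∀ u ∈ s, θ u ≠ 0) {t : ℝ} (ht : t ∈ s)
    (he : e t = e₁ t) (hp : p t = p₁ t) : Set.EqOn e e₁ s := by
  intro u hu
  have const : ∀ {e p : ℝ → Fin 3 → ℝ}, IsFrenetSystem s θ β τ e p → ∀ i j,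
      frameTensor (θ u) (e u) (p u) (e₁ u) (p₁ u) i j =
        frameTensor (θ t) (e t) (p t) (e₁ t) (p₁ t) i j := by
    intro e p h i j
    have hd := fun v hv => h.hasDerivAt_frameTensor h₁ hv (hθ v hv) (h0 v hv) i j
    exact hs.is_const_of_deriv_eq_zero hs'
      (fun v hv => (hd v hv).differentiableAt.differentiableWithinAt)
      (fun v hv => (hd v hv).deriv) hu ht
  ext i
  rw [← h₁.frameTensor_contract hu (e u) (p u), ← h₁.frameTensor_contract hu (e₁ u) (p₁ u)]
  congr 1
  ext j
  rw [const h, const h₁, he, hp]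

end IsFrenetSystem

/-- The tangent field of a unit-speed spacelike Frenet curve satisfies the Frenet equations. -/
theorem isFrenetSystem_of_unit_speed {s : Set ℝ} (hs : IsOpen s) {e : ℝ → Fin 3 → ℝ}
    {θ τ : ℝ → ℝ}
    (he : ∀ u ∈ s, DifferentiableAt ℝ e u) (hp : ∀ u ∈ s, DifferentiableAt ℝ (deriv e) u)
    (hunit : ∀ u ∈ s, mink (e u) (e u) = 1)
    (hθ : ∀ u ∈ s, θ u = mink (deriv e u) (deriv e u)) (h0 : ∀ u ∈ s, θ u ≠ 0)
    (hτ : ∀ u ∈ s, τ u =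
      -(Matrix.det (Matrix.of ![e u, deriv e u, deriv (deriv e) u]) / θ u)) :
    (∀ u ∈ s, HasDerivAt θ (deriv θ u) u) ∧ IsFrenetSystem s θ (deriv θ) τ e (deriv e) := by
  have hep : ∀ u ∈ s, mink (e u) (deriv e u) = 0 := by
    intro u hu
    have hd := (he u hu).hasDerivAt.mink (he u hu).hasDerivAt
    have hc : HasDerivAt (fun u => mink (e u) (e u)) 0 u :=
      (hasDerivAt_const u (1 : ℝ)).congr_of_eventuallyEq
        (Filter.eventuallyEq_of_mem (hs.mem_nhds hu) hunit)
    have := hd.unique hc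
    rw [mink_comm_s15 (deriv e u)] at this
    linarith
  have hdθ : ∀ u ∈ s, HasDerivAt θ (2 * mink (deriv (deriv e) u) (deriv e u)) u := by
    intro u hu
    refine (((hp u hu).hasDerivAt.mink (hp u hu).hasDerivAt).congr_of_eventuallyEq
      (Filter.eventuallyEq_of_mem (hs.mem_nhds hu) hθ)).congr_deriv ?_
    rw [mink_comm_s15 (deriv e u)]
    ring
  refine ⟨fun u hu => (hdθ u hu).differentiableAt.hasDerivAt, hunit, hep,
    fun u hu => (he u hu).hasDerivAt, fun u hu => (hp u hu).hasDerivAt.congr_deriv ?_⟩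
  have hqe : mink (deriv (deriv e) u) (e u) = -θ u := by
    have hd := (he u hu).hasDerivAt.mink (hp u hu).hasDerivAt
    have hc : HasDerivAt (fun u => mink (e u) (deriv e u)) 0 u :=
      (hasDerivAt_const u (0 : ℝ)).congr_of_eventuallyEq
        (Filter.eventuallyEq_of_mem (hs.mem_nhds hu) hep)
    have := hd.unique hc
    rw [← hθ u hu, mink_comm_s15 (e u)] at this
    linarith
  have key := gram_smul_eq (e u) (deriv e u) (deriv (deriv e) u)
  rw [hunit u hu, hep u hu, ← hθ u hu, hqe, mink_lcross_eq_det] at key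
  have h0u := h0 u hu
  rw [(hdθ u hu).deriv, hτ u hu]
  ext i
  have ki := congrFun key i
  simp only [Pi.add_apply, Pi.sub_apply, Pi.smul_apply, smul_eq_mul] at ki ⊢
  field_simp
  linear_combination ki

/-- Uniqueness of unit-speed spacelike Frenet curves in `𝕃³`:
two unit-speed spacelike Frenet curves with the same causal curvature `θ` and
torsion `τ` on an open interval `I ∋ 0`, the same initial point, and the same
initial Frenet frame `(e, n, b)` at `0`, coincide on `I`. -/
theorem frenet_curve_uniqueness
    (a b : ℝ) (ha : a < 0) (hb : 0 < b)
    (γ γ₁ : ℝ → Fin 3 → ℝ)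
    (hγ : ContDiffOn ℝ (⊤ : ℕ∞) γ (Set.Ioo a b))
    (hγ₁ : ContDiffOn ℝ (⊤ : ℕ∞) γ₁ (Set.Ioo a b))
    (hunit : ∀ u ∈ Set.Ioo a b, mink (deriv γ u) (deriv γ u) = 1)
    (hunit₁ : ∀ u ∈ Set.Ioo a b, mink (deriv γ₁ u) (deriv γ₁ u) = 1)
    (θ θ₁ τ τ₁ : ℝ → ℝ)
    (hθ : θ = fun u => mink (deriv (deriv γ) u) (deriv (deriv γ) u))
    (hθ₁ : θ₁ = fun u => mink (deriv (deriv γ₁) u) (deriv (deriv γ₁) u))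
    (hθne : ∀ u ∈ Set.Ioo a b, θ u ≠ 0)
    (hθ₁ne : ∀ u ∈ Set.Ioo a b, θ₁ u ≠ 0)
    (hτ : τ = fun u => -(Matrix.det (Matrix.of
      ![deriv γ u, deriv (deriv γ) u, deriv (deriv (deriv γ)) u]) / θ u))
    (hτ₁ : τ₁ = fun u => -(Matrix.det (Matrix.of
      ![deriv γ₁ u, deriv (deriv γ₁) u, deriv (deriv (deriv γ₁)) u]) / θ₁ u))
    (n n₁ bb bb₁ : ℝ → Fin 3 → ℝ)
    (hn : n = fun u => (Real.sqrt |θ u|)⁻¹ • deriv (deriv γ) u)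
    (hn₁ : n₁ = fun u => (Real.sqrt |θ₁ u|)⁻¹ • deriv (deriv γ₁) u)
    (hbb : bb = fun u => (if 0 < θ u then (-1 : ℝ) else 1) • lcross (deriv γ u) (n u))
    (hbb₁ : bb₁ = fun u => (if 0 < θ₁ u then (-1 : ℝ) else 1) • lcross (deriv γ₁ u) (n₁ u))
    (hinit : γ 0 = γ₁ 0)
    (hθeq : ∀ u ∈ Set.Ioo a b, θ u = θ₁ u)
    (hτeq : ∀ u ∈ Set.Ioo a b, τ u = τ₁ u)
    (hframe : deriv γ 0 = deriv γ₁ 0 ∧ n 0 = n₁ 0 ∧ bb 0 = bb₁ 0) :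
    ∀ u ∈ Set.Ioo a b, γ u = γ₁ u := by
  have hs : IsOpen (Set.Ioo a b) := isOpen_Ioo
  have hs' : IsPreconnected (Set.Ioo a b) := isPreconnected_Ioo
  have h0 : (0 : ℝ) ∈ Set.Ioo a b := ⟨ha, hb⟩
  have smooth : ∀ {f : ℝ → Fin 3 → ℝ}, ContDiffOn ℝ (⊤ : ℕ∞) f (Set.Ioo a b) →
      ContDiffOn ℝ (⊤ : ℕ∞) (deriv f) (Set.Ioo a b) := fun hf =>
    ((contDiffOn_infty_iff_deriv_of_isOpen hs).1 hf).2
  have diff : ∀ {f : ℝ → Fin 3 → ℝ}, ContDiffOn ℝ (⊤ : ℕ∞) f (Set.Ioo a b) →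
      ∀ u ∈ Set.Ioo a b, DifferentiableAt ℝ f u := fun hf u hu =>
    (hf.differentiableOn (by simp)).differentiableAt (hs.mem_nhds hu)
  obtain ⟨hdθ, hF⟩ := isFrenetSystem_of_unit_speed (τ := τ) hs (diff (smooth hγ))
    (diff (smooth (smooth hγ))) hunit (fun u _ => congrFun hθ u) hθne
    (fun u _ => congrFun hτ u)
  obtain ⟨-, hF₁⟩ := isFrenetSystem_of_unit_speed (θ := θ) (τ := τ) hs (diff (smooth hγ₁))
    (diff (smooth (smooth hγ₁))) hunit₁ (fun u hu => (hθeq u hu).trans (congrFun hθ₁ u)) hθne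
    (fun u hu => by rw [hτeq u hu, hθeq u hu]; exact congrFun hτ₁ u)
  have hp : deriv (deriv γ) 0 = deriv (deriv γ₁) 0 := by
    have hn0 := hframe.2.1
    simp only [hn, hn₁] at hn0
    rw [← hθeq 0 h0] at hn0
    exact smul_right_injective _
      (inv_ne_zero (Real.sqrt_ne_zero'.2 (abs_pos.2 (hθne 0 h0)))) hn0
  have he := hF.eqOn hs hs' hF₁ hdθ hθne h0 hframe.1 hp
  exact hs.eqOn_of_deriv_eq hs' (hγ.differentiableOn (by simp))
    (hγ₁.differentiableOn (by simp)) he h0 hinit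
end
end

section
/- Local isometric realization of real analytic generic mixed type metrics (analogue of the Janet–Cartan theorem, in L-coordinates): Let E, G be real analytic on an open neighborhood of (0,0) ∈ ℝ² with E > 0, E(u,0) = 1 for all u near 0, and E_v(0,0) ≠ 0; set λ := E·G and assume λ(0,0) = 0, dλ(0,0) ≠ 0, and that either (I) G(u,0) = 0 and G_v(u,0) ≠ 0 for all u near 0, or (II) λ(u,0) ≠ 0 for all u ≠ 0 near 0. Then there exist an open neighborhood U of (0,0) and a real analytic immersion f : U → 𝕃³ such that ⟨f_u, f_u⟩ = E, ⟨f_u, f_v⟩ = 0 and ⟨f_v, f_v⟩ = G on U, i.e. the metric E du² + G dv² is realized as the first fundamental form of a mixed type surface in 𝕃³. -/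
noncomputable section

/-- Formal power series in two variables; variable `0` is `u` and variable `1` is `v`. -/
abbrev DoubleSeries : Type := MvPowerSeries (Fin 2) ℝ

namespace DoubleSeries

open MvPowerSeries Finsupp Filter Topology NNReal ENNReal

/-- The weighted `ℓ¹` norm of the coefficients of `f` is at most `c`. -/
def NormLE (w : (Fin 2 →₀ ℕ) → ℝ) (f : DoubleSeries) (c : ℝ) : Prop :=
  ∀ S : Finset (Fin 2 →₀ ℕ), ∑ n ∈ S, |coeff n f| * w n ≤ c

/-- Positive submultiplicative weights on exponents. -/
structure IsWeight (w : (Fin 2 →₀ ℕ) → ℝ) : Prop where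
  pos : ∀ n, 0 < w n
  add_le : ∀ m n, w (m + n) ≤ w m * w n

section NormLE

variable {w : (Fin 2 →₀ ℕ) → ℝ} {f g : DoubleSeries} {b c : ℝ}

theorem NormLE.nonneg (hf : NormLE w f c) : 0 ≤ c := by simpa using hf ∅

theorem NormLE.mono (hf : NormLE w f b) (h : b ≤ c) : NormLE w f c := fun S => (hf S).trans h

theorem NormLE.coeff_le (hw : IsWeight w) (hf : NormLE w f c) (n : Fin 2 →₀ ℕ) :
    |coeff n f| ≤ c / w n := by
  rw [le_div_iff₀ (hw.pos n)]
  simpa using hf {n}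

theorem NormLE.summable (hw : IsWeight w) (hf : NormLE w f c) :
    Summable fun n => |coeff n f| * w n :=
  summable_of_sum_le (fun n => mul_nonneg (abs_nonneg _) (hw.pos n).le) hf

theorem NormLE.tsum_le (hw : IsWeight w) (hf : NormLE w f c) :
    ∑' n, |coeff n f| * w n ≤ c :=
  (hf.summable hw).tsum_le_of_sum_le hf

theorem NormLE.of_summable (hw : IsWeight w) (hf : Summable fun n => |coeff n f| * w n) :
    NormLE w f (∑' n, |coeff n f| * w n) := fun S =>
  hf.sum_le_tsum S fun n _ => mul_nonneg (abs_nonneg _) (hw.pos n).le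

theorem normLE_zero : NormLE w 0 0 := fun S => by simp

theorem NormLE.neg (hf : NormLE w f c) : NormLE w (-f) c := fun S => by simpa using hf S

theorem NormLE.add (hw : IsWeight w) (hf : NormLE w f b) (hg : NormLE w g c) :
    NormLE w (f + g) (b + c) := fun S => by
  refine le_trans ?_ (add_le_add (hf S) (hg S))
  rw [← Finset.sum_add_distrib]
  refine Finset.sum_le_sum fun n _ => ?_
  rw [← add_mul, map_add]
  exact mul_le_mul_of_nonneg_right (abs_add_le _ _) (hw.pos n).le

theorem NormLE.sub (hw : IsWeight w) (hf : NormLE w f b) (hg : NormLE w g c) :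
    NormLE w (f - g) (b + c) := by
  rw [sub_eq_add_neg]
  exact hf.add hw hg.neg

theorem NormLE.mul (hw : IsWeight w) (hf : NormLE w f b) (hg : NormLE w g c) :
    NormLE w (f * g) (b * c) := by
  obtain ⟨F, hF⟩ : ∃ F : (Fin 2 →₀ ℕ) → ℝ, F = fun n => |coeff n f| * w n := ⟨_, rfl⟩
  obtain ⟨G, hG⟩ : ∃ G : (Fin 2 →₀ ℕ) → ℝ, G = fun n => |coeff n g| * w n := ⟨_, rfl⟩
  have F0 : ∀ n, 0 ≤ F n := fun n => hF ▸ mul_nonneg (abs_nonneg _) (hw.pos n).le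
  have G0 : ∀ n, 0 ≤ G n := fun n => hG ▸ mul_nonneg (abs_nonneg _) (hw.pos n).le
  have sf : Summable F := hF ▸ hf.summable hw
  have sg : Summable G := hG ▸ hg.summable hw
  have tf : ∑' n, F n ≤ b := hF ▸ hf.tsum_le hw
  have tg : ∑' n, G n ≤ c := hG ▸ hg.tsum_le hw
  have sp : Summable fun x : (Fin 2 →₀ ℕ) × (Fin 2 →₀ ℕ) => F x.1 * G x.2 :=
    sf.mul_of_nonneg sg F0 G0
  have key : ∀ n, |coeff n (f * g)| * w n ≤
      ∑ x ∈ Finset.HasAntidiagonal.antidiagonal n, F x.1 * G x.2 := by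
    intro n
    rw [coeff_mul]
    refine (mul_le_mul_of_nonneg_right (Finset.abs_sum_le_sum_abs _ _) (hw.pos n).le).trans ?_
    rw [Finset.sum_mul]
    refine Finset.sum_le_sum fun x hx => ?_
    rw [Finset.HasAntidiagonal.mem_antidiagonal] at hx
    rw [abs_mul, ← hx, hF, hG]
    have := mul_le_mul_of_nonneg_left (hw.add_le x.1 x.2)
      (mul_nonneg (abs_nonneg (coeff x.1 f)) (abs_nonneg (coeff x.2 g)))
    linarith
  intro S
  refine (Finset.sum_le_sum fun n _ => key n).trans ?_
  have s3 := summable_sum_mul_antidiagonal_of_summable_mul (f := F) (g := G) sp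
  refine (s3.sum_le_tsum S fun n _ => Finset.sum_nonneg fun x _ =>
    mul_nonneg (F0 x.1) (G0 x.2)).trans ?_
  rw [← sf.tsum_mul_tsum_eq_tsum_sum_antidiagonal sg sp]
  exact mul_le_mul tf tg (tsum_nonneg G0) hf.nonneg

/-- A bound for an operator that moves coefficients along an injection. -/
theorem NormLE.of_shift {w' : (Fin 2 →₀ ℕ) → ℝ} {σ : (Fin 2 →₀ ℕ) → (Fin 2 →₀ ℕ)}
    {P : Set (Fin 2 →₀ ℕ)} {ε : ℝ} (hε : 0 ≤ ε) (hσ : Set.InjOn σ P)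
    (h0 : ∀ n, n ∉ P → coeff n g = 0)
    (h : ∀ n ∈ P, |coeff n g| * w' n ≤ ε * (|coeff (σ n) f| * w (σ n)))
    (hf : NormLE w f c) : NormLE w' g (ε * c) := by
  classical
  intro S
  have : ∑ n ∈ S, |coeff n g| * w' n = ∑ n ∈ S with n ∈ P, |coeff n g| * w' n := by
    rw [Finset.sum_filter]
    refine Finset.sum_congr rfl fun n _ => ?_
    split_ifs with hn
    · rfl
    · simp [h0 n hn]
  rw [this]
  refine (Finset.sum_le_sum fun n hn => h n (Finset.mem_filter.1 hn).2).trans ?_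
  rw [← Finset.mul_sum]
  refine mul_le_mul_of_nonneg_left ?_ hε
  rw [← Finset.sum_image (f := fun m => |coeff m f| * w m) (g := σ)]
  · exact hf _
  · intro a ha b hb
    exact hσ (Finset.mem_filter.1 ha).2 (Finset.mem_filter.1 hb).2

theorem normLE_of_tendsto {F : ℕ → DoubleSeries} (hF : ∀ k, NormLE w (F k) c)
    (hlim : ∀ n, Tendsto (fun k => coeff n (F k)) atTop (𝓝 (coeff n f))) : NormLE w f c := by
  intro S
  refine le_of_tendsto' (tendsto_finsetSum S fun n _ => ((hlim n).abs).mul_const (w n))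
    fun k => hF k S

end NormLE

/-- The contraction principle for triples of double series. -/
theorem exists_fixedPoint {w : (Fin 2 →₀ ℕ) → ℝ} (hw : IsWeight w) {R : ℝ} (hR : 0 ≤ R)
    (Ψ : (Fin 3 → DoubleSeries) → Fin 3 → DoubleSeries)
    (hmap : ∀ h, (∀ a, NormLE w (h a) R) → ∀ a, NormLE w (Ψ h a) R)
    (hlip : ∀ h h' d, (∀ a, NormLE w (h a) R) → (∀ a, NormLE w (h' a) R) →
      (∀ a, NormLE w (h a - h' a) d) → ∀ a, NormLE w (Ψ h a - Ψ h' a) (1 / 2 * d)) :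
    ∃ h, (∀ a, NormLE w (h a) R) ∧ Ψ h = h := by
  set H : ℕ → Fin 3 → DoubleSeries := fun k => Ψ^[k] 0 with hH
  have Hs : ∀ k, H (k + 1) = Ψ (H k) := fun k => Function.iterate_succ_apply' _ _ _
  have HR : ∀ k a, NormLE w (H k a) R := by
    intro k
    induction k with
    | zero => intro a; exact normLE_zero.mono hR
    | succ k ih => rw [Hs]; exact hmap _ ih
  have Hd : ∀ k a, NormLE w (H (k + 1) a - H k a) (R * (1 / 2) ^ k) := by
    intro k
    induction k with
    | zero =>
      intro a
      have : H 0 a = 0 := rfl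
      simpa [this] using HR 1 a
    | succ k ih =>
      intro a
      rw [Hs (k + 1), Hs k]
      refine (hlip _ _ _ (Hs k ▸ HR (k + 1)) (HR k) (Hs k ▸ ih) a).mono (le_of_eq ?_)
      ring
  have Hd' : ∀ k l a, NormLE w (H (k + l) a - H k a) (2 * R * (1 / 2) ^ k) := by
    intro k l a
    have : NormLE w (H (k + l) a - H k a) (2 * R * (1 / 2) ^ k - 2 * R * (1 / 2) ^ (k + l)) := by
      induction l with
      | zero => simpa using normLE_zero
      | succ l ih =>
        have := ih.add hw (Hd (k + l) a)
        rw [show H (k + (l + 1)) a - H k a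
          = H (k + l) a - H k a + (H (k + l + 1) a - H (k + l) a) by
            rw [← add_assoc]; ring]
        refine this.mono (le_of_eq ?_)
        rw [← add_assoc, pow_succ]
        ring
    refine this.mono ?_
    have : 0 ≤ 2 * R * (1 / 2) ^ (k + l) := by positivity
    linarith
  have hcauchy : ∀ a n, CauchySeq fun k => coeff n (H k a) := by
    intro a n
    refine cauchySeq_of_le_geometric (1 / 2) (R / w n) (by norm_num) fun k => ?_
    rw [dist_comm, Real.dist_eq, ← map_sub]
    refine ((Hd k a).coeff_le hw n).trans (le_of_eq ?_)
    ring
  choose L hL using fun a n => cauchySeq_tendsto_of_complete (hcauchy a n)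
  let h : Fin 3 → DoubleSeries := fun a n => L a n
  have hlim : ∀ a n, Tendsto (fun k => coeff n (H k a)) atTop (𝓝 (coeff n (h a))) := hL
  have hR' : ∀ a, NormLE w (h a) R := fun a => normLE_of_tendsto (fun k => HR k a) (hlim a)
  have hdist : ∀ k a, NormLE w (h a - H k a) (2 * R * (1 / 2) ^ k) := by
    intro k a
    refine normLE_of_tendsto (fun l => Hd' k l a) fun n => ?_
    simp only [map_sub]
    refine Tendsto.sub_const ?_ _
    have := (hlim a n).comp (tendsto_add_atTop_nat k)
    simpa [Function.comp_def, add_comm] using this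
  refine ⟨h, hR', ?_⟩
  funext a
  ext n
  refine tendsto_nhds_unique ?_ ((tendsto_add_atTop_iff_nat 1).2 (hlim a n))
  have hz : Tendsto (fun k : ℕ => 1 / 2 * (2 * R * (1 / 2 : ℝ) ^ k) / w n) atTop (𝓝 0) := by
    have : Tendsto (fun k : ℕ => (1 / 2 : ℝ) ^ k) atTop (𝓝 0) :=
      tendsto_pow_atTop_nhds_zero_of_lt_one (by norm_num) (by norm_num)
    simpa only [mul_zero, zero_div] using
      ((this.const_mul (2 * R)).const_mul (1 / 2)).div_const (w n)
  rw [← tendsto_sub_nhds_zero_iff]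
  refine squeeze_zero_norm (fun k => ?_) hz
  rw [← map_sub, Hs, Real.norm_eq_abs, ← abs_neg, ← map_neg, neg_sub]
  exact (hlip _ _ _ hR' (HR k) (hdist k) a).coeff_le hw n

/-- The isotropic weight `ρ ^ (i + j)`. -/
def polyWeight (ρ : ℝ) (n : Fin 2 →₀ ℕ) : ℝ := ρ ^ (n 0 + n 1)

/-- The weight `r ^ i * s ^ j / (i + j).choose i`, for which `∂ᵤ ∂ᵥ⁻¹` has norm at most `s / r`. -/
def binomWeight (r s : ℝ) (n : Fin 2 →₀ ℕ) : ℝ :=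
  r ^ n 0 * s ^ n 1 / ((n 0 + n 1).choose (n 0) : ℝ)

theorem isWeight_polyWeight {ρ : ℝ} (hρ : 0 < ρ) : IsWeight (polyWeight ρ) where
  pos n := pow_pos hρ _
  add_le m n := le_of_eq <| by
    simp only [polyWeight, Finsupp.add_apply, ← pow_add]
    congr 1
    ring

theorem choose_mul_choose_le (a b c d : ℕ) :
    (a + b).choose a * (c + d).choose c ≤ (a + c + (b + d)).choose (a + c) := by
  rw [show a + c + (b + d) = (a + b) + (c + d) by ring, Nat.add_choose_eq (a + b) (c + d)]
  exact Finset.single_le_sum (f := fun ij : ℕ × ℕ => (a + b).choose ij.1 * (c + d).choose ij.2)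
    (fun _ _ => Nat.zero_le _) (Finset.HasAntidiagonal.mem_antidiagonal.2 (rfl : (a, c).1 + (a, c).2 = a + c))

theorem isWeight_binomWeight {r s : ℝ} (hr : 0 < r) (hs : 0 < s) :
    IsWeight (binomWeight r s) where
  pos n := div_pos (by positivity) (by exact_mod_cast Nat.choose_pos (Nat.le_add_right _ _))
  add_le m n := by
    have h1 : (0 : ℝ) < ((m 0 + m 1).choose (m 0) : ℝ) := by
      exact_mod_cast Nat.choose_pos (Nat.le_add_right _ _)
    have h2 : (0 : ℝ) < ((n 0 + n 1).choose (n 0) : ℝ) := by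
      exact_mod_cast Nat.choose_pos (Nat.le_add_right _ _)
    have h3 : ((m 0 + m 1).choose (m 0) : ℝ) * ((n 0 + n 1).choose (n 0) : ℝ)
        ≤ ((m 0 + n 0 + (m 1 + n 1)).choose (m 0 + n 0) : ℝ) := by
      exact_mod_cast choose_mul_choose_le _ _ _ _
    simp only [binomWeight, Finsupp.add_apply]
    rw [div_mul_div_comm, pow_add, pow_add]
    refine (div_le_div_of_nonneg_left (by positivity) (by positivity) h3).trans (le_of_eq ?_)
    ring

theorem binomWeight_le_polyWeight {r s : ℝ} (hs : 0 < s) (hsr : s ≤ r) (n : Fin 2 →₀ ℕ) :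
    binomWeight r s n ≤ polyWeight r n := by
  have hr : 0 < r := hs.trans_le hsr
  have h1 : (1 : ℝ) ≤ ((n 0 + n 1).choose (n 0) : ℝ) := by
    exact_mod_cast Nat.choose_pos (Nat.le_add_right _ _)
  rw [binomWeight, polyWeight, pow_add]
  refine (div_le_self (by positivity) h1).trans ?_
  gcongr

theorem polyWeight_half_le_binomWeight {r s : ℝ} (hs : 0 < s) (hsr : s ≤ r) (n : Fin 2 →₀ ℕ) :
    polyWeight (s / 2) n ≤ binomWeight r s n := by
  have h1 : (0 : ℝ) < ((n 0 + n 1).choose (n 0) : ℝ) := by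
    exact_mod_cast Nat.choose_pos (Nat.le_add_right _ _)
  have h2 : ((n 0 + n 1).choose (n 0) : ℝ) ≤ 2 ^ (n 0 + n 1) := by
    exact_mod_cast Nat.choose_le_two_pow _ _
  rw [binomWeight, polyWeight, div_pow]
  refine (div_le_div_of_nonneg_left (by positivity) h1 h2).trans ?_
  rw [pow_add]
  gcongr

theorem NormLE.weight_mono {w w' : (Fin 2 →₀ ℕ) → ℝ} {f : DoubleSeries} {c : ℝ}
    (hf : NormLE w f c) (h : ∀ n, w' n ≤ w n) : NormLE w' f c := fun S =>
  (Finset.sum_le_sum fun n _ => mul_le_mul_of_nonneg_left (h n) (abs_nonneg _)).trans (hf S)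

/-- A series without constant term is small in a weight of small radius. -/
theorem NormLE.shrink {ρ δ c : ℝ} {f : DoubleSeries} (hρ : 0 < ρ) (hδ : 0 < δ)
    (hδ1 : δ ≤ 1) (h0 : coeff 0 f = 0) (hf : NormLE (polyWeight ρ) f c) :
    NormLE (polyWeight (δ * ρ)) f (δ * c) := by
  refine hf.of_shift (σ := id) (P := {n | n ≠ 0}) hδ.le (Set.injOn_id _) ?_ ?_
  · intro n hn
    have : n = 0 := by simpa using hn
    rw [this, h0]
  · intro n hn
    have hn' : n 0 + n 1 ≠ 0 := by
      intro h
      apply hn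
      ext i
      fin_cases i <;> simp <;> omega
    obtain ⟨k, hk⟩ := Nat.exists_eq_add_one_of_ne_zero hn'
    simp only [polyWeight, hk, id, mul_pow]
    have : δ ^ (k + 1) ≤ δ := pow_le_of_le_one hδ.le hδ1 (by omega)
    calc |coeff n f| * (δ ^ (k + 1) * ρ ^ (k + 1))
        ≤ |coeff n f| * (δ * ρ ^ (k + 1)) := by gcongr
      _ = _ := by ring

theorem normLE_C {w : (Fin 2 →₀ ℕ) → ℝ} (hw : w 0 = 1) (a : ℝ) :
    NormLE w (C a : DoubleSeries) |a| := by
  classical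
  intro S
  have : ∀ n ∈ S, |coeff n (C a : DoubleSeries)| * w n = if n = 0 then |a| else 0 := by
    intro n _
    rw [coeff_C]
    split_ifs with h
    · rw [h, hw, mul_one]
    · simp
  rw [Finset.sum_congr rfl this, Finset.sum_ite_eq']
  split_ifs
  · exact le_rfl
  · exact abs_nonneg a

/-- Formal differentiation with respect to the first variable. -/
abbrev du : Derivation ℝ DoubleSeries DoubleSeries := pderiv ℝ 0

/-- Formal differentiation with respect to the second variable. -/
abbrev dv : Derivation ℝ DoubleSeries DoubleSeries := pderiv ℝ 1

theorem du_dv (f : DoubleSeries) : du (dv f) = dv (du f) := by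
  ext n
  simp only [coeff_pderiv, Finsupp.add_apply, add_right_comm n (single 0 1) (single 1 1)]
  simp
  ring

/-- Formal integration with respect to the second variable. -/
def vint (f : DoubleSeries) : DoubleSeries := fun n =>
  if n 1 = 0 then 0 else coeff (n - single 1 1) f / n 1

theorem coeff_vint_of_eq_zero (f : DoubleSeries) {n : Fin 2 →₀ ℕ} (hn : n 1 = 0) :
    coeff n (vint f) = 0 := if_pos hn

theorem coeff_vint_add (f : DoubleSeries) (n : Fin 2 →₀ ℕ) :
    coeff (n + single 1 1) (vint f) = coeff n f / (n 1 + 1) := by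
  have : coeff (n + single 1 1) (vint f) = if (n + single 1 1 : Fin 2 →₀ ℕ) 1 = 0 then 0 else
    coeff (n + single 1 1 - single 1 1) f / ((n + single 1 1 : Fin 2 →₀ ℕ) 1 : ℕ) := rfl
  rw [this]
  simp

theorem exists_eq_add_single {n : Fin 2 →₀ ℕ} {i : Fin 2} (hn : n i ≠ 0) :
    ∃ m, n = m + single i 1 :=
  ⟨n - single i 1, (tsub_add_cancel_of_le (by simpa using Nat.one_le_iff_ne_zero.2 hn)).symm⟩

theorem dv_vint (f : DoubleSeries) : dv (vint f) = f := by
  ext n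
  rw [coeff_pderiv, coeff_vint_add]
  field_simp

theorem vint_sub (f g : DoubleSeries) : vint (f - g) = vint f - vint g := by
  ext n
  by_cases hn : n 1 = 0
  · simp [coeff_vint_of_eq_zero _ hn]
  · obtain ⟨m, rfl⟩ := exists_eq_add_single hn
    simp only [map_sub, coeff_vint_add]
    ring

theorem du_vint (f : DoubleSeries) : du (vint f) = vint (du f) := by
  ext n
  by_cases hn : n 1 = 0
  · rw [coeff_vint_of_eq_zero _ hn, coeff_pderiv, coeff_vint_of_eq_zero, zero_mul]
    simpa using hn
  · obtain ⟨m, rfl⟩ := exists_eq_add_single hn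
    rw [coeff_vint_add, coeff_pderiv, coeff_pderiv, add_right_comm, coeff_vint_add]
    simp
    ring

theorem X_dvd_vint (f : DoubleSeries) : (X 1 : DoubleSeries) ∣ vint f :=
  X_dvd_iff.2 fun _ hn => coeff_vint_of_eq_zero f hn

/-- A series is determined by its `v`-derivative and its restriction to `v = 0`. -/
theorem eq_zero_of_dv {f : DoubleSeries} (h : dv f = 0) (h0 : (X 1 : DoubleSeries) ∣ f) :
    f = 0 := by
  ext n
  by_cases hn : n 1 = 0
  · exact X_dvd_iff.1 h0 n hn
  · obtain ⟨m, rfl⟩ := exists_eq_add_single hn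
    have := congrArg (coeff m) h
    rw [coeff_pderiv, map_zero] at this
    rcases mul_eq_zero.1 this with h | h
    · simpa using h
    · exact absurd h (by positivity)

theorem NormLE.vint {r s c : ℝ} {f : DoubleSeries} (hr : 0 < r) (hs : 0 < s)
    (hf : NormLE (binomWeight r s) f c) : NormLE (binomWeight r s) (vint f) (s * c) := by
  refine hf.of_shift (σ := fun n => n - single 1 1) (P := {n | n 1 ≠ 0}) hs.le ?_ ?_ ?_
  · intro a ha b hb hab
    obtain ⟨m, rfl⟩ := exists_eq_add_single ha
    obtain ⟨m', rfl⟩ := exists_eq_add_single hb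
    simpa using hab
  · intro n hn
    exact coeff_vint_of_eq_zero f (by simpa using hn)
  · intro n hn
    obtain ⟨m, rfl⟩ := exists_eq_add_single hn
    simp only [add_tsub_cancel_right]
    rw [coeff_vint_add]
    have h1 : (0 : ℝ) < ((m 0 + m 1).choose (m 0) : ℝ) := by
      exact_mod_cast Nat.choose_pos (Nat.le_add_right _ _)
    have h2 : ((m 0 + m 1).choose (m 0) : ℝ) ≤ ((m 0 + (m 1 + 1)).choose (m 0) : ℝ) := by
      exact_mod_cast Nat.choose_le_choose _ (by omega)
    have h3 : binomWeight r s (m + single 1 1) ≤ s * binomWeight r s m := by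
      have : binomWeight r s (m + single 1 1)
          = s * (r ^ m 0 * s ^ m 1) / ((m 0 + (m 1 + 1)).choose (m 0) : ℝ) := by
        simp only [binomWeight, Finsupp.add_apply]
        simp [pow_succ]
        ring
      rw [this, binomWeight, ← mul_div_assoc]
      exact div_le_div_of_nonneg_left (by positivity) h1 h2
    have h4 : |coeff m f / ((m 1 : ℝ) + 1)| ≤ |coeff m f| := by
      rw [abs_div]
      refine div_le_self (abs_nonneg _) ?_
      rw [abs_of_nonneg (by positivity)]
      linarith [(Nat.cast_nonneg (m 1) : (0 : ℝ) ≤ m 1)]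
    calc _ ≤ |coeff m f| * (s * binomWeight r s m) :=
          mul_le_mul h4 h3 ((isWeight_binomWeight hr hs).pos _).le (abs_nonneg _)
      _ = _ := by ring

theorem NormLE.du_vint {r s c : ℝ} {f : DoubleSeries} (hr : 0 < r) (hs : 0 < s)
    (hf : NormLE (binomWeight r s) f c) :
    NormLE (binomWeight r s) (du (DoubleSeries.vint f)) (s / r * c) := by
  refine hf.of_shift (σ := fun n => n - single 1 1 + single 0 1) (P := {n | n 1 ≠ 0})
    (div_pos hs hr).le ?_ ?_ ?_
  · intro a ha b hb hab
    obtain ⟨m, rfl⟩ := exists_eq_add_single ha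
    obtain ⟨m', rfl⟩ := exists_eq_add_single hb
    simpa using hab
  · intro n hn
    rw [DoubleSeries.du_vint]
    exact coeff_vint_of_eq_zero _ (by simpa using hn)
  · intro n hn
    obtain ⟨m, rfl⟩ := exists_eq_add_single hn
    simp only [add_tsub_cancel_right]
    rw [DoubleSeries.du_vint, coeff_vint_add, coeff_pderiv]
    have h1 : (0 : ℝ) < ((m 0 + m 1 + 1).choose (m 0) : ℝ) := by
      exact_mod_cast Nat.choose_pos (by omega)
    have h2 : (0 : ℝ) < ((m 0 + m 1 + 1).choose (m 0 + 1) : ℝ) := by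
      exact_mod_cast Nat.choose_pos (by omega)
    have h3 : ((m 0 + m 1 + 1).choose (m 0 + 1) : ℝ) * (m 0 + 1)
        = ((m 0 + m 1 + 1).choose (m 0) : ℝ) * (m 1 + 1) := by
      have := Nat.choose_succ_right_eq (m 0 + m 1 + 1) (m 0)
      rw [show m 0 + m 1 + 1 - m 0 = m 1 + 1 by omega] at this
      exact_mod_cast this
    have e1 : binomWeight r s (m + single 1 1)
        = r ^ m 0 * s ^ (m 1 + 1) / ((m 0 + m 1 + 1).choose (m 0) : ℝ) := by
      simp [binomWeight, add_assoc]
    have e2 : binomWeight r s (m + single 0 1)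
        = r ^ (m 0 + 1) * s ^ m 1 / ((m 0 + m 1 + 1).choose (m 0 + 1) : ℝ) := by
      simp [binomWeight, add_right_comm]
    rw [e1, e2, abs_div, abs_mul, abs_of_nonneg (by positivity : (0 : ℝ) ≤ (m 0 : ℝ) + 1),
      abs_of_nonneg (by positivity : (0 : ℝ) ≤ (m 1 : ℝ) + 1)]
    refine le_of_eq ?_
    field_simp
    linear_combination (|coeff (m + single 0 1) f| * s * s ^ m 1 * r ^ m 0 * r) * h3

theorem NormLE.pderiv {ρ c : ℝ} {f : DoubleSeries} (hρ : 0 < ρ) (i : Fin 2)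
    (hf : NormLE (polyWeight ρ) f c) :
    NormLE (polyWeight (ρ / 2)) (MvPowerSeries.pderiv ℝ i f) (1 / ρ * c) := by
  refine hf.of_shift (σ := fun n => n + single i 1) (P := Set.univ) (by positivity)
    (fun a _ b _ hab => by simpa using hab) (fun n hn => absurd (Set.mem_univ n) hn) ?_
  intro n _
  rw [coeff_pderiv, abs_mul, abs_of_nonneg (by positivity : (0 : ℝ) ≤ (n i : ℝ) + 1)]
  have e1 : polyWeight ρ (n + single i 1) = ρ * ρ ^ (n 0 + n 1) := by
    rw [← pow_succ']
    simp only [polyWeight, Finsupp.add_apply]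
    congr 1
    fin_cases i <;> simp <;> omega
  have h1 : (n i : ℝ) + 1 ≤ 2 ^ (n 0 + n 1) := by
    have h2 : n i ≤ n 0 + n 1 := by fin_cases i <;> simp
    have h3 : n i + 1 ≤ 2 ^ (n 0 + n 1) := Nat.lt_of_le_of_lt h2 Nat.lt_two_pow_self
    exact_mod_cast h3
  rw [e1, polyWeight, div_pow]
  calc |coeff (n + single i 1) f| * ((n i : ℝ) + 1) * (ρ ^ (n 0 + n 1) / 2 ^ (n 0 + n 1))
      ≤ |coeff (n + single i 1) f| * 2 ^ (n 0 + n 1) *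
          (ρ ^ (n 0 + n 1) / 2 ^ (n 0 + n 1)) := by gcongr
    _ = _ := by field_simp

/-- Absolute convergence on a neighbourhood of the origin. -/
def Conv (f : DoubleSeries) : Prop := ∃ ρ : ℝ, 0 < ρ ∧ ∃ c, NormLE (polyWeight ρ) f c

theorem NormLE.radius_mono {ρ ρ' c : ℝ} {f : DoubleSeries} (hρ' : 0 ≤ ρ') (h : ρ' ≤ ρ)
    (hf : NormLE (polyWeight ρ) f c) : NormLE (polyWeight ρ') f c :=
  hf.weight_mono fun _ => pow_le_pow_left₀ hρ' h _

theorem conv_C (a : ℝ) : Conv (C a) := ⟨1, one_pos, _, normLE_C (by simp [polyWeight]) a⟩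

theorem Conv.sub {f g : DoubleSeries} (hf : Conv f) (hg : Conv g) : Conv (f - g) := by
  obtain ⟨ρ, hρ, c, hc⟩ := hf
  obtain ⟨ρ', hρ', c', hc'⟩ := hg
  have h : 0 < min ρ ρ' := lt_min hρ hρ'
  exact ⟨min ρ ρ', h, _, (hc.radius_mono h.le (min_le_left _ _)).sub (isWeight_polyWeight h)
    (hc'.radius_mono h.le (min_le_right _ _))⟩

theorem Conv.pderiv {f : DoubleSeries} (hf : Conv f) (i : Fin 2) :
    Conv (MvPowerSeries.pderiv ℝ i f) := by
  obtain ⟨ρ, hρ, c, hc⟩ := hf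
  exact ⟨ρ / 2, by positivity, _, hc.pderiv hρ i⟩

/-- Finitely many convergent series have a common radius and a common bound. -/
theorem exists_uniform {ι : Type*} [Fintype ι] (D : ι → DoubleSeries) (hD : ∀ i, Conv (D i)) :
    ∃ ρ : ℝ, 0 < ρ ∧ ρ ≤ 1 ∧ ∃ K, 0 ≤ K ∧ ∀ i, NormLE (polyWeight ρ) (D i) K := by
  choose ρ hρ c hc using hD
  have hev : ∀ᶠ x in 𝓝[>] (0 : ℝ), (∀ i, x < ρ i) ∧ x < 1 := by
    refine nhdsWithin_le_nhds ?_
    exact ((eventually_all.2 fun i => eventually_lt_nhds (hρ i))).and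
      (eventually_lt_nhds one_pos)
  obtain ⟨x, ⟨hx, hx1⟩, hx0⟩ := (hev.and self_mem_nhdsWithin).exists
  have hx0 : 0 < x := hx0
  have hc0 : ∀ i, 0 ≤ c i := fun i => (hc i).nonneg
  exact ⟨x, hx0, hx1.le, ∑ i, c i, Finset.sum_nonneg fun i _ => hc0 i, fun i =>
    ((hc i).radius_mono hx0.le (hx i).le).mono
      (Finset.single_le_sum (fun i _ => hc0 i) (Finset.mem_univ i))⟩

/-- A nonlinear operator is bounded by `B` and `L`-Lipschitz on the ball of radius `R`. -/
structure LipOn (w : (Fin 2 →₀ ℕ) → ℝ) (R : ℝ) (Φ : (Fin 3 → DoubleSeries) → DoubleSeries)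
    (B L : ℝ) : Prop where
  bound : ∀ h, (∀ a, NormLE w (h a) R) → NormLE w (Φ h) B
  lip : ∀ h h' d, (∀ a, NormLE w (h a) R) → (∀ a, NormLE w (h' a) R) →
    (∀ a, NormLE w (h a - h' a) d) → NormLE w (Φ h - Φ h') (L * d)

section LipOn

variable {w : (Fin 2 →₀ ℕ) → ℝ} {R B B' L L' : ℝ}
  {Φ Φ' : (Fin 3 → DoubleSeries) → DoubleSeries}

theorem lipOn_const {f : DoubleSeries} (hf : NormLE w f B) : LipOn w R (fun _ => f) B 0 where
  bound _ _ := hf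
  lip h h' d _ _ _ := by simpa using normLE_zero

theorem lipOn_apply (a : Fin 3) : LipOn w R (fun h => h a) R 1 where
  bound h hh := hh a
  lip h h' d _ _ hd := by simpa using hd a

theorem LipOn.add (hw : IsWeight w) (h : LipOn w R Φ B L) (h' : LipOn w R Φ' B' L') :
    LipOn w R (fun x => Φ x + Φ' x) (B + B') (L + L') where
  bound x hx := (h.bound x hx).add hw (h'.bound x hx)
  lip x y d hx hy hd := by
    have := (h.lip x y d hx hy hd).add hw (h'.lip x y d hx hy hd)
    rwa [← add_mul, show Φ x - Φ y + (Φ' x - Φ' y) = Φ x + Φ' x - (Φ y + Φ' y) by ring] at this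

theorem LipOn.neg (h : LipOn w R Φ B L) : LipOn w R (fun x => -Φ x) B L where
  bound x hx := (h.bound x hx).neg
  lip x y d hx hy hd := by
    have := (h.lip x y d hx hy hd).neg
    rwa [show -(Φ x - Φ y) = -Φ x - -Φ y by ring] at this

theorem LipOn.sub (hw : IsWeight w) (h : LipOn w R Φ B L) (h' : LipOn w R Φ' B' L') :
    LipOn w R (fun x => Φ x - Φ' x) (B + B') (L + L') := by
  simp only [sub_eq_add_neg]
  exact h.add hw h'.neg

theorem LipOn.mul (hw : IsWeight w) (h : LipOn w R Φ B L) (h' : LipOn w R Φ' B' L') :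
    LipOn w R (fun x => Φ x * Φ' x) (B * B') (L * B' + B * L') where
  bound x hx := (h.bound x hx).mul hw (h'.bound x hx)
  lip x y d hx hy hd := by
    have := ((h.lip x y d hx hy hd).mul hw (h'.bound x hx)).add hw
      ((h.bound y hy).mul hw (h'.lip x y d hx hy hd))
    rw [show (Φ x - Φ y) * Φ' x + Φ y * (Φ' x - Φ' y) = Φ x * Φ' x - Φ y * Φ' y by ring] at this
    exact this.mono (le_of_eq (by ring))

theorem LipOn.comp_linear {T : DoubleSeries → DoubleSeries} {ε : ℝ}
    (hT : ∀ f c, NormLE w f c → NormLE w (T f) (ε * c)) (hsub : ∀ f g, T (f - g) = T f - T g)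
    (h : LipOn w R Φ B L) : LipOn w R (fun x => T (Φ x)) (ε * B) (ε * L) where
  bound x hx := hT _ _ (h.bound x hx)
  lip x y d hx hy hd := by
    rw [← hsub, mul_assoc]
    exact hT _ _ (h.lip x y d hx hy hd)

theorem LipOn.mono (h : LipOn w R Φ B L) (hB : B ≤ B') (hL : L ≤ L') :
    LipOn w R Φ B' L' where
  bound x hx := (h.bound x hx).mono hB
  lip x y d hx hy hd := (h.lip x y d hx hy hd).mono
    (mul_le_mul_of_nonneg_right hL (hd 0).nonneg)

/-- The Minkowski form on triples of double series. -/
def fmink (x y : Fin 3 → DoubleSeries) : DoubleSeries := x 0 * y 0 + x 1 * y 1 - x 2 * y 2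

theorem lipOn_fmink (hw : IsWeight w) {Φ Φ' : (Fin 3 → DoubleSeries) → Fin 3 → DoubleSeries}
    (h : ∀ a, LipOn w R (fun x => Φ x a) B L) (h' : ∀ a, LipOn w R (fun x => Φ' x a) B' L') :
    LipOn w R (fun x => fmink (Φ x) (Φ' x)) (3 * (B * B')) (3 * (L * B' + B * L')) :=
  ((((h 0).mul hw (h' 0)).add hw ((h 1).mul hw (h' 1))).sub hw ((h 2).mul hw (h' 2))).mono
    (le_of_eq (by ring)) (le_of_eq (by ring))

end LipOn

/-- Cauchy–Kovalevskaya for the second order system that prescribes the Minkowski products of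
`∂ᵥ² f` with `∂ᵤ f`, `∂ᵥ f` and `∂ᵤ² f`. -/
theorem exists_solution (A β : Fin 3 → DoubleSeries) (e b : ℝ) (hb : b ≠ 0)
    (hA : ∀ a, Conv (A a)) (hβ : ∀ a, Conv (β a))
    (hu : ∀ a, coeff 0 (du (A a)) = ![1, 0, 0] a)
    (hv : ∀ a, coeff 0 (dv (A a)) = ![0, e, b] a)
    (huu : ∀ a, coeff 0 (du (du (A a))) = ![0, 1, 0] a) :
    ∃ h f : Fin 3 → DoubleSeries, (∀ a, Conv (f a)) ∧ (∀ a, f a = A a + vint (vint (h a))) ∧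
      fmink h (fun a => du (f a)) = β 0 ∧ fmink h (fun a => dv (f a)) = β 1 ∧
      fmink h (fun a => du (du (f a))) =
        fmink (fun a => du (dv (f a))) (fun a => du (dv (f a))) + β 2 := by
  let p : Fin 3 → DoubleSeries := fun a => du (A a) - C (![1, 0, 0] a : ℝ)
  let q : Fin 3 → DoubleSeries := fun a => dv (A a) - C (![0, e, b] a : ℝ)
  let s : Fin 3 → DoubleSeries := fun a => du (du (A a)) - C (![0, 1, 0] a : ℝ)
  let t : Fin 3 → DoubleSeries := fun a => du (dv (A a))
  have hp : ∀ a, Conv (p a) := fun a => ((hA a).pderiv 0).sub (conv_C _)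
  have hq : ∀ a, Conv (q a) := fun a => ((hA a).pderiv 1).sub (conv_C _)
  have hs : ∀ a, Conv (s a) := fun a => (((hA a).pderiv 0).pderiv 0).sub (conv_C _)
  have ht : ∀ a, Conv (t a) := fun a => ((hA a).pderiv 1).pderiv 0
  have p0 : ∀ a, coeff 0 (p a) = 0 := fun a => by
    simp only [p, map_sub, hu, coeff_zero_C, sub_self]
  have q0 : ∀ a, coeff 0 (q a) = 0 := fun a => by
    simp only [q, map_sub, hv, coeff_zero_C, sub_self]
  have s0 : ∀ a, coeff 0 (s a) = 0 := fun a => by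
    simp only [s, map_sub, huu, coeff_zero_C, sub_self]
  obtain ⟨ρ, hρ, hρ1, K, hK, hD⟩ := exists_uniform (ι := Fin 6 × Fin 3)
    (fun i => ![p, q, s, t, β, A] i.1 i.2) (by
      rintro ⟨i, a⟩
      fin_cases i
      exacts [hp a, hq a, hs a, ht a, hβ a, hA a])
  -- the bounds of the three components, as functions of the scale `δ`
  let B0 : ℝ → ℝ → ℝ := fun R δ => K + 3 * (R * (δ * (K + R)))
  let B1 : ℝ → ℝ → ℝ := fun R δ =>
    K + 3 * ((K + δ * R) * (K + δ * R)) + 3 * (R * (δ * (K + R)))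
  let B2 : ℝ → ℝ → ℝ := fun R δ =>
    |(-1 / b)| * (K + |e| * B1 R δ + 3 * (R * (δ * (K + R))))
  let L0 : ℝ → ℝ → ℝ := fun R δ => 3 * (δ * (K + R) + R * δ)
  let L1 : ℝ → ℝ → ℝ := fun R δ =>
    3 * (δ * (K + δ * R) + (K + δ * R) * δ) + 3 * (δ * (K + R) + R * δ)
  let L2 : ℝ → ℝ → ℝ := fun R δ =>
    |(-1 / b)| * (|e| * L1 R δ + 3 * (δ * (K + R) + R * δ))
  obtain ⟨R, hR0, hRB0, hRB1, hRB2⟩ :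
      ∃ R : ℝ, 0 < R ∧ K < R ∧ K + 3 * (K * K) < R ∧ |(-1 / b)| * (K + |e| * (K + 3 * (K * K))) < R := by
    have n1 : 0 ≤ |(-1 / b)| * (K + |e| * (K + 3 * (K * K))) := by positivity
    have n2 : 0 ≤ 3 * (K * K) := by positivity
    exact ⟨K + 3 * (K * K) + |(-1 / b)| * (K + |e| * (K + 3 * (K * K))) + 1, by linarith,
      by linarith, by linarith, by linarith⟩
  have hev : ∀ᶠ δ in 𝓝[>] (0 : ℝ), (B0 R δ < R ∧ B1 R δ < R ∧ B2 R δ < R) ∧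
      (L0 R δ < 1 / 2 ∧ L1 R δ < 1 / 2 ∧ L2 R δ < 1 / 2) ∧ δ < 1 := by
    refine nhdsWithin_le_nhds ?_
    have aux : ∀ (φ : ℝ → ℝ) (m : ℝ), Continuous φ → φ 0 < m → ∀ᶠ δ in 𝓝 (0 : ℝ), φ δ < m :=
      fun φ m hφ h0 => hφ.continuousAt.eventually_lt continuousAt_const h0
    refine ((aux _ _ ?_ ?_).and ((aux _ _ ?_ ?_).and (aux _ _ ?_ ?_))).and
      (((aux _ _ ?_ ?_).and ((aux _ _ ?_ ?_).and (aux _ _ ?_ ?_))).and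
        (eventually_lt_nhds one_pos))
    · simp only [B0]; fun_prop
    · simpa [B0] using hRB0
    · simp only [B1]; fun_prop
    · simpa [B1] using hRB1
    · simp only [B1, B2]; fun_prop
    · simpa [B1, B2] using hRB2
    · simp only [L0]; fun_prop
    · simp [L0]
    · simp only [L1]; fun_prop
    · simp [L1]
    · simp only [L1, L2]; fun_prop
    · simp [L1, L2]
  obtain ⟨δ, ⟨⟨hB0, hB1, hB2⟩, ⟨hL0, hL1, hL2⟩, hδ1⟩, hδ⟩ := (hev.and self_mem_nhdsWithin).exists
  have hδ : 0 < δ := hδ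
  have hr : 0 < δ * ρ := mul_pos hδ hρ
  have hs' : 0 < δ * (δ * ρ) := mul_pos hδ hr
  have hsr : δ * (δ * ρ) ≤ δ * ρ := by
    have := mul_le_mul_of_nonneg_right hδ1.le hr.le
    linarith
  have hrρ : δ * ρ ≤ ρ := by
    have := mul_le_mul_of_nonneg_right hδ1.le hρ.le
    linarith
  obtain ⟨w, hwdef⟩ : ∃ w, w = binomWeight (δ * ρ) (δ * (δ * ρ)) := ⟨_, rfl⟩
  have hw : IsWeight w := hwdef ▸ isWeight_binomWeight hr hs'
  have small : ∀ f : DoubleSeries, coeff 0 f = 0 → NormLE (polyWeight ρ) f K →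
      NormLE w f (δ * K) := fun f h0 hf => hwdef ▸
    (hf.shrink hρ hδ hδ1.le h0).weight_mono (binomWeight_le_polyWeight hs' hsr)
  have bdd : ∀ f : DoubleSeries, NormLE (polyWeight ρ) f K → NormLE w f K := fun f hf => hwdef ▸
    (hf.radius_mono hr.le hrρ).weight_mono (binomWeight_le_polyWeight hs' hsr)
  have opI : ∀ f c, NormLE w f c → NormLE w (vint f) (δ * c) := by
    intro f c hf
    rw [hwdef] at hf ⊢
    refine (hf.vint hr hs').mono (mul_le_mul_of_nonneg_right ?_ hf.nonneg)
    have : δ * ρ ≤ 1 := hrρ.trans hρ1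
    have := mul_le_mul_of_nonneg_left this hδ.le
    linarith
  have opD : ∀ f c, NormLE w f c → NormLE w (du (vint f)) (δ * c) := by
    intro f c hf
    rw [hwdef] at hf ⊢
    refine (hf.du_vint hr hs').mono (le_of_eq ?_)
    rw [mul_div_assoc, div_self hr.ne', mul_one]
  have subD : ∀ f g, du (vint (f - g)) = du (vint f) - du (vint g) := fun f g => by
    rw [vint_sub, map_sub]
  have hδδ : δ * (δ * R) ≤ δ * R := by
    have := mul_le_mul_of_nonneg_right hδ1.le (mul_nonneg hδ.le hR0.le)
    linarith
  have hδδ1 : δ * (δ * 1) ≤ δ := by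
    have := mul_le_mul_of_nonneg_right hδ1.le hδ.le
    linarith
  let U : (Fin 3 → DoubleSeries) → Fin 3 → DoubleSeries := fun h a =>
    p a + du (vint (vint (h a)))
  let V : (Fin 3 → DoubleSeries) → Fin 3 → DoubleSeries := fun h a => q a + vint (h a)
  let W : (Fin 3 → DoubleSeries) → Fin 3 → DoubleSeries := fun h a =>
    s a + du (vint (du (vint (h a))))
  let T : (Fin 3 → DoubleSeries) → Fin 3 → DoubleSeries := fun h a => t a + du (vint (h a))
  have hU : ∀ a, LipOn w R (fun h => U h a) (δ * (K + R)) δ := fun a =>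
    ((lipOn_const (small _ (p0 a) (hD (0, a)))).add hw
      (((lipOn_apply a).comp_linear opI vint_sub).comp_linear opD subD)).mono
      (by linarith) (by linarith)
  have hV : ∀ a, LipOn w R (fun h => V h a) (δ * (K + R)) δ := fun a =>
    ((lipOn_const (small _ (q0 a) (hD (1, a)))).add hw
      ((lipOn_apply a).comp_linear opI vint_sub)).mono (by linarith) (by linarith)
  have hW : ∀ a, LipOn w R (fun h => W h a) (δ * (K + R)) δ := fun a =>
    ((lipOn_const (small _ (s0 a) (hD (2, a)))).add hw
      (((lipOn_apply a).comp_linear opD subD).comp_linear opD subD)).mono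
      (by linarith) (by linarith)
  have hT : ∀ a, LipOn w R (fun h => T h a) (K + δ * R) δ := fun a =>
    ((lipOn_const (bdd _ (hD (3, a)))).add hw
      ((lipOn_apply a).comp_linear opD subD)).mono le_rfl (by linarith)
  have hβ' : ∀ a, LipOn w R (fun _ => β a) K 0 := fun a => lipOn_const (bdd _ (hD (4, a)))
  have w0 : w 0 = 1 := by simp [hwdef, binomWeight]
  have hid : ∀ a, LipOn w R (fun h : Fin 3 → DoubleSeries => h a) R 1 := lipOn_apply
  let Ψ0 : (Fin 3 → DoubleSeries) → DoubleSeries := fun h => β 0 - fmink h (U h)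
  let Ψ1 : (Fin 3 → DoubleSeries) → DoubleSeries := fun h =>
    β 2 + fmink (T h) (T h) - fmink h (W h)
  let Ψ2 : (Fin 3 → DoubleSeries) → DoubleSeries := fun h =>
    C (-1 / b) * (β 1 - C e * Ψ1 h - fmink h (V h))
  have hΨ0 : LipOn w R Ψ0 (B0 R δ) (L0 R δ) :=
    ((hβ' 0).sub hw (lipOn_fmink hw hid hU)).mono le_rfl (le_of_eq (by simp only [L0]; ring))
  have hΨ1 : LipOn w R Ψ1 (B1 R δ) (L1 R δ) :=
    (((hβ' 2).add hw (lipOn_fmink hw hT hT)).sub hw (lipOn_fmink hw hid hW)).mono le_rfl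
      (le_of_eq (by simp only [L1]; ring))
  have hΨ2 : LipOn w R Ψ2 (B2 R δ) (L2 R δ) :=
    ((lipOn_const (normLE_C w0 _)).mul hw (((hβ' 1).sub hw
      ((lipOn_const (normLE_C w0 _)).mul hw hΨ1)).sub hw (lipOn_fmink hw hid hV))).mono
      le_rfl (le_of_eq (by simp only [L2]; ring))
  obtain ⟨h, hh, hfix⟩ := exists_fixedPoint hw hR0.le (fun h => ![Ψ0 h, Ψ1 h, Ψ2 h])
    (by
      intro h hh a
      fin_cases a
      exacts [(hΨ0.bound h hh).mono hB0.le, (hΨ1.bound h hh).mono hB1.le,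
        (hΨ2.bound h hh).mono hB2.le])
    (by
      intro h h' d hh hh' hd a
      have hd0 := (hd 0).nonneg
      fin_cases a
      exacts [(hΨ0.lip h h' d hh hh' hd).mono (mul_le_mul_of_nonneg_right hL0.le hd0),
        (hΨ1.lip h h' d hh hh' hd).mono (mul_le_mul_of_nonneg_right hL1.le hd0),
        (hΨ2.lip h h' d hh hh' hd).mono (mul_le_mul_of_nonneg_right hL2.le hd0)])
  have f0 : Ψ0 h = h 0 := congrFun hfix 0
  have f1 : Ψ1 h = h 1 := congrFun hfix 1
  have f2 : Ψ2 h = h 2 := congrFun hfix 2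
  have eu : ∀ a, du (A a + vint (vint (h a))) = U h a + C (![1, 0, 0] a : ℝ) := fun a => by
    simp only [U, p, map_add]
    ring
  have ev : ∀ a, dv (A a + vint (vint (h a))) = V h a + C (![0, e, b] a : ℝ) := fun a => by
    simp only [V, q, map_add, dv_vint]
    ring
  have euu : ∀ a, du (du (A a + vint (vint (h a)))) = W h a + C (![0, 1, 0] a : ℝ) := fun a => by
    simp only [W, s, map_add, du_vint]
    ring
  have euv : ∀ a, du (dv (A a + vint (vint (h a)))) = T h a := fun a => by
    simp only [T, t, map_add, dv_vint]
  have hbb : (C b : DoubleSeries) * C (-1 / b) = -1 := by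
    rw [← map_mul, mul_div_cancel₀ _ hb, map_neg, map_one]
  refine ⟨h, fun a => A a + vint (vint (h a)), fun a => ?_, fun a => rfl, ?_, ?_, ?_⟩
  · refine ⟨δ * (δ * ρ) / 2, by positivity, _, NormLE.weight_mono
      ((bdd _ (hD (5, a))).add hw (opI _ _ (opI _ _ (hh a)))) fun n => ?_⟩
    rw [hwdef]
    exact polyWeight_half_le_binomWeight hs' hsr n
  · simp only [eu]
    simp only [Ψ0] at f0
    simp only [fmink, Matrix.cons_val, map_zero, map_one] at f0 ⊢
    linear_combination -f0
  · simp only [ev]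
    simp only [Ψ2, f1] at f2
    simp only [fmink, Matrix.cons_val, map_zero] at f2 ⊢
    linear_combination (C b : DoubleSeries) * f2 -
      (β 1 - C e * h 1 - (h 0 * V h 0 + h 1 * V h 1 - h 2 * V h 2)) * hbb
  · simp only [euu, euv]
    simp only [Ψ1] at f1
    simp only [fmink, Matrix.cons_val, map_zero, map_one] at f1 ⊢
    linear_combination -f1

/-- The value of a double series at a point. -/
def evalAt (f : DoubleSeries) (q : ℝ × ℝ) : ℝ := ∑' n, coeff n f * (q.1 ^ n 0 * q.2 ^ n 1)

section Eval

variable {ρ b c : ℝ} {f g : DoubleSeries} {q : ℝ × ℝ}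

theorem abs_monomial_le (h1 : |q.1| ≤ ρ) (h2 : |q.2| ≤ ρ) (n : Fin 2 →₀ ℕ) :
    |q.1 ^ n 0 * q.2 ^ n 1| ≤ polyWeight ρ n := by
  rw [abs_mul, abs_pow, abs_pow, polyWeight, pow_add]
  exact mul_le_mul (pow_le_pow_left₀ (abs_nonneg _) h1 _) (pow_le_pow_left₀ (abs_nonneg _) h2 _)
    (by positivity) (pow_nonneg ((abs_nonneg _).trans h1) _)

theorem NormLE.summable_abs (hρ : 0 < ρ) (hf : NormLE (polyWeight ρ) f c) (h1 : |q.1| ≤ ρ)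
    (h2 : |q.2| ≤ ρ) : Summable fun n => |coeff n f * (q.1 ^ n 0 * q.2 ^ n 1)| := by
  refine Summable.of_nonneg_of_le (fun n => abs_nonneg _) (fun n => ?_)
    (hf.summable (isWeight_polyWeight hρ))
  rw [abs_mul]
  exact mul_le_mul_of_nonneg_left (abs_monomial_le h1 h2 n) (abs_nonneg _)

theorem NormLE.hasSum (hρ : 0 < ρ) (hf : NormLE (polyWeight ρ) f c) (h1 : |q.1| ≤ ρ)
    (h2 : |q.2| ≤ ρ) : HasSum (fun n => coeff n f * (q.1 ^ n 0 * q.2 ^ n 1)) (evalAt f q) :=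
  (hf.summable_abs hρ h1 h2).of_abs.hasSum

theorem NormLE.evalAt_add (hρ : 0 < ρ) (hf : NormLE (polyWeight ρ) f b)
    (hg : NormLE (polyWeight ρ) g c) (h1 : |q.1| ≤ ρ) (h2 : |q.2| ≤ ρ) :
    evalAt (f + g) q = evalAt f q + evalAt g q := by
  rw [← ((hf.hasSum hρ h1 h2).add (hg.hasSum hρ h1 h2)).tsum_eq, evalAt]
  simp only [map_add, add_mul]

theorem evalAt_neg : evalAt (-f) q = -evalAt f q := by
  simp only [evalAt, map_neg, neg_mul, tsum_neg]

theorem NormLE.evalAt_mul (hρ : 0 < ρ) (hf : NormLE (polyWeight ρ) f b)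
    (hg : NormLE (polyWeight ρ) g c) (h1 : |q.1| ≤ ρ) (h2 : |q.2| ≤ ρ) :
    evalAt (f * g) q = evalAt f q * evalAt g q := by
  obtain ⟨F, hF⟩ : ∃ F : (Fin 2 →₀ ℕ) → ℝ, F = fun n => coeff n f * (q.1 ^ n 0 * q.2 ^ n 1) :=
    ⟨_, rfl⟩
  obtain ⟨G, hG⟩ : ∃ G : (Fin 2 →₀ ℕ) → ℝ, G = fun n => coeff n g * (q.1 ^ n 0 * q.2 ^ n 1) :=
    ⟨_, rfl⟩
  have sf : Summable fun n => ‖F n‖ := hF ▸ hf.summable_abs hρ h1 h2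
  have sg : Summable fun n => ‖G n‖ := hG ▸ hg.summable_abs hρ h1 h2
  have key := sf.of_norm.tsum_mul_tsum_eq_tsum_sum_antidiagonal sg.of_norm
    (summable_mul_of_summable_norm sf sg)
  have e1 : evalAt f q = ∑' n, F n := by rw [hF]; rfl
  have e2 : evalAt g q = ∑' n, G n := by rw [hG]; rfl
  rw [e1, e2, key, evalAt]
  refine tsum_congr fun n => ?_
  rw [coeff_mul, Finset.sum_mul]
  refine Finset.sum_congr rfl fun x hx => ?_
  rw [Finset.HasAntidiagonal.mem_antidiagonal] at hx
  rw [← hx, hF, hG]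
  simp only [Finsupp.add_apply, pow_add]
  ring

theorem evalAt_C (a : ℝ) : evalAt (C a) q = a := by
  classical
  rw [evalAt, tsum_eq_single 0]
  · simp
  · intro n hn
    simp [coeff_C, hn]

theorem evalAt_zero : evalAt f 0 = coeff 0 f := by
  rw [evalAt, tsum_eq_single 0]
  · simp
  · intro n hn
    have : n 0 ≠ 0 ∨ n 1 ≠ 0 := by
      by_contra! h
      exact hn (Finsupp.ext fun i => by fin_cases i; exacts [h.1, h.2])
    rcases this with h | h <;> simp [h]

end Eval

/-- `F` is the sum of the double series `f` near the origin. -/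
def Rep (F : ℝ × ℝ → ℝ) (f : DoubleSeries) : Prop := Conv f ∧ F =ᶠ[𝓝 0] evalAt f

theorem eventually_abs_le {ρ : ℝ} (hρ : 0 < ρ) :
    ∀ᶠ q : ℝ × ℝ in 𝓝 0, |q.1| ≤ ρ ∧ |q.2| ≤ ρ := by
  filter_upwards [Metric.closedBall_mem_nhds (0 : ℝ × ℝ) hρ] with q hq
  have := mem_closedBall_zero_iff.1 hq
  exact ⟨(norm_fst_le q).trans this, (norm_snd_le q).trans this⟩

section Rep

variable {F G : ℝ × ℝ → ℝ} {f g : DoubleSeries}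

theorem Conv.rep (hf : Conv f) : Rep (evalAt f) f := ⟨hf, .rfl⟩

theorem Rep.congr (hF : Rep F f) (h : G =ᶠ[𝓝 0] F) : Rep G f := ⟨hF.1, h.trans hF.2⟩

theorem Rep.eventuallyEq (hF : Rep F f) (hG : Rep G f) : F =ᶠ[𝓝 0] G := hF.2.trans hG.2.symm

theorem Rep.coeff_zero (hF : Rep F f) : coeff 0 f = F 0 := by
  rw [hF.2.self_of_nhds, evalAt_zero]

theorem rep_C (a : ℝ) : Rep (fun _ => a) (C a) :=
  ⟨conv_C a, .of_forall fun _ => (evalAt_C a).symm⟩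

theorem Conv.exists_common (hf : Conv f) (hg : Conv g) : ∃ ρ > 0, ∃ b c,
    NormLE (polyWeight ρ) f b ∧ NormLE (polyWeight ρ) g c := by
  obtain ⟨r, hr, b, hb⟩ := hf
  obtain ⟨s, hs, c, hc⟩ := hg
  have hm : 0 < min r s := lt_min hr hs
  exact ⟨min r s, hm, b, c, hb.radius_mono hm.le (min_le_left _ _),
    hc.radius_mono hm.le (min_le_right _ _)⟩

theorem Rep.add (hF : Rep F f) (hG : Rep G g) : Rep (fun q => F q + G q) (f + g) := by
  obtain ⟨ρ, hρ, b, c, hb, hc⟩ := hF.1.exists_common hG.1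
  refine ⟨⟨ρ, hρ, _, hb.add (isWeight_polyWeight hρ) hc⟩, ?_⟩
  filter_upwards [hF.2, hG.2, eventually_abs_le hρ] with q h1 h2 h3
  rw [h1, h2, hb.evalAt_add hρ hc h3.1 h3.2]

theorem Rep.neg (hF : Rep F f) : Rep (fun q => -F q) (-f) := by
  obtain ⟨⟨ρ, hρ, b, hb⟩, h⟩ := hF
  refine ⟨⟨ρ, hρ, _, hb.neg⟩, ?_⟩
  filter_upwards [h] with q h1
  rw [h1, evalAt_neg]

theorem Rep.sub (hF : Rep F f) (hG : Rep G g) : Rep (fun q => F q - G q) (f - g) := by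
  simpa only [sub_eq_add_neg] using hF.add hG.neg

theorem Rep.mul (hF : Rep F f) (hG : Rep G g) : Rep (fun q => F q * G q) (f * g) := by
  obtain ⟨ρ, hρ, b, c, hb, hc⟩ := hF.1.exists_common hG.1
  refine ⟨⟨ρ, hρ, _, hb.mul (isWeight_polyWeight hρ) hc⟩, ?_⟩
  filter_upwards [hF.2, hG.2, eventually_abs_le hρ] with q h1 h2 h3
  rw [h1, h2, hb.evalAt_mul hρ hc h3.1 h3.2]

end Rep

/-- The terms of `pderiv ℝ i f`, with index shifted by one in the direction `i`. -/
def derivTerm (i : Fin 2) (f : DoubleSeries) (n : Fin 2 →₀ ℕ) (q : ℝ × ℝ) : ℝ :=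
  if n i = 0 then 0 else coeff (n - single i 1) (pderiv ℝ i f) *
    (q.1 ^ (n - single i 1 : Fin 2 →₀ ℕ) 0 * q.2 ^ (n - single i 1 : Fin 2 →₀ ℕ) 1)

theorem derivTerm_of_eq_zero {i : Fin 2} (f : DoubleSeries) {n : Fin 2 →₀ ℕ} (hn : n i = 0)
    (q : ℝ × ℝ) : derivTerm i f n q = 0 := if_pos hn

theorem derivTerm_add (i : Fin 2) (f : DoubleSeries) (n : Fin 2 →₀ ℕ) (q : ℝ × ℝ) :
    derivTerm i f (n + single i 1) q = coeff n (pderiv ℝ i f) * (q.1 ^ n 0 * q.2 ^ n 1) := by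
  rw [derivTerm, add_tsub_cancel_right, if_neg (by simp)]

theorem injective_add_single (i : Fin 2) :
    Function.Injective fun n : Fin 2 →₀ ℕ => n + single i 1 := fun a b h => by simpa using h

theorem hasSum_derivTerm {ρ c : ℝ} {i : Fin 2} {f : DoubleSeries} {q : ℝ × ℝ} (hρ : 0 < ρ)
    (hf : NormLE (polyWeight ρ) (pderiv ℝ i f) c) (h1 : |q.1| ≤ ρ) (h2 : |q.2| ≤ ρ) :
    HasSum (fun n => derivTerm i f n q) (evalAt (pderiv ℝ i f) q) := by
  rw [← (injective_add_single i).hasSum_iff]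
  · simpa only [Function.comp_def, derivTerm_add] using hf.hasSum hρ h1 h2
  · intro n hn
    by_contra h
    refine hn ?_
    have h0 : n i ≠ 0 := fun h0 => h (derivTerm_of_eq_zero f h0 q)
    obtain ⟨m, rfl⟩ := exists_eq_add_single h0
    exact ⟨m, rfl⟩

theorem summable_derivTerm_bound {ρ c : ℝ} {i : Fin 2} {f : DoubleSeries} (hρ : 0 < ρ)
    (hf : NormLE (polyWeight ρ) (pderiv ℝ i f) c) :
    Summable fun n => |derivTerm i f n (ρ, ρ)| := by
  rw [← (injective_add_single i).summable_iff]
  · simpa only [Function.comp_def, derivTerm_add] using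
      hf.summable_abs (q := (ρ, ρ)) hρ (abs_of_pos hρ).le (abs_of_pos hρ).le
  · intro n hn
    by_contra h
    refine hn ?_
    have h0 : n i ≠ 0 := fun h0 => h (by rw [derivTerm_of_eq_zero f h0, abs_zero])
    obtain ⟨m, rfl⟩ := exists_eq_add_single h0
    exact ⟨m, rfl⟩

theorem abs_derivTerm_le {ρ : ℝ} (i : Fin 2) (f : DoubleSeries) (n : Fin 2 →₀ ℕ) {q : ℝ × ℝ}
    (h1 : |q.1| ≤ ρ) (h2 : |q.2| ≤ ρ) :
    |derivTerm i f n q| ≤ |derivTerm i f n (ρ, ρ)| := by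
  unfold derivTerm
  split_ifs with h
  · exact le_rfl
  · rw [abs_mul, abs_mul (coeff _ _) (_ * _)]
    refine mul_le_mul_of_nonneg_left ((abs_monomial_le h1 h2 _).trans ?_) (abs_nonneg _)
    rw [polyWeight, pow_add]
    exact le_abs_self _

theorem hasFDerivAt_term (f : DoubleSeries) (n : Fin 2 →₀ ℕ) (q : ℝ × ℝ) :
    HasFDerivAt (fun q : ℝ × ℝ => coeff n f * (q.1 ^ n 0 * q.2 ^ n 1))
      (derivTerm 0 f n q • ContinuousLinearMap.fst ℝ ℝ ℝ +
        derivTerm 1 f n q • ContinuousLinearMap.snd ℝ ℝ ℝ) q := by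
  have h := (((hasFDerivAt_fst (𝕜 := ℝ) (p := q)).pow (n 0)).mul
    ((hasFDerivAt_snd (𝕜 := ℝ) (p := q)).pow (n 1))).const_mul (coeff n f)
  refine h.congr_fderiv ?_
  have e0 : derivTerm 0 f n q = coeff n f * (n 0 * q.1 ^ (n 0 - 1) * q.2 ^ n 1) := by
    by_cases hn : n 0 = 0
    · simp [derivTerm_of_eq_zero f hn, hn]
    · obtain ⟨m, rfl⟩ := exists_eq_add_single hn
      rw [derivTerm_add, coeff_pderiv]
      simp
      ring
  have e1 : derivTerm 1 f n q = coeff n f * (n 1 * q.1 ^ n 0 * q.2 ^ (n 1 - 1)) := by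
    by_cases hn : n 1 = 0
    · simp [derivTerm_of_eq_zero f hn, hn]
    · obtain ⟨m, rfl⟩ := exists_eq_add_single hn
      rw [derivTerm_add, coeff_pderiv]
      simp
      ring
  rw [e0, e1]
  ext <;> simp [mul_comm, mul_left_comm]

theorem Conv.hasFDerivAt {f : DoubleSeries} (hf : Conv f) : ∀ᶠ q in 𝓝 (0 : ℝ × ℝ),
    HasFDerivAt (evalAt f) (evalAt (du f) q • ContinuousLinearMap.fst ℝ ℝ ℝ +
      evalAt (dv f) q • ContinuousLinearMap.snd ℝ ℝ ℝ) q := by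
  obtain ⟨ρ, hρ, b, c, hb, hc⟩ := (hf.pderiv 0).exists_common (hf.pderiv 1)
  filter_upwards [Metric.ball_mem_nhds (0 : ℝ × ℝ) hρ] with q hq
  have hle : ∀ {q : ℝ × ℝ}, q ∈ Metric.ball (0 : ℝ × ℝ) ρ → |q.1| ≤ ρ ∧ |q.2| ≤ ρ := by
    intro q hq
    have := (mem_ball_zero_iff.1 hq).le
    exact ⟨(norm_fst_le q).trans this, (norm_snd_le q).trans this⟩
  have key := hasFDerivAt_tsum_of_isPreconnected
    (((summable_derivTerm_bound hρ hb).add (summable_derivTerm_bound hρ hc)))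
    Metric.isOpen_ball (convex_ball (0 : ℝ × ℝ) ρ).isPreconnected
    (fun n q _ => hasFDerivAt_term f n q) ?_ (Metric.mem_ball_self hρ) ?_ hq
  · refine key.congr_fderiv ?_
    exact (((hasSum_derivTerm hρ hb (hle hq).1 (hle hq).2).smul_const _).add
      ((hasSum_derivTerm hρ hc (hle hq).1 (hle hq).2).smul_const _)).tsum_eq
  · intro n q hq
    have hq := hle hq
    refine (norm_add_le _ _).trans (add_le_add ?_ ?_)
    · rw [norm_smul]
      exact (mul_le_of_le_one_right (norm_nonneg _) (ContinuousLinearMap.norm_fst_le _ _ _)).trans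
        (abs_derivTerm_le 0 f n hq.1 hq.2)
    · rw [norm_smul]
      exact (mul_le_of_le_one_right (norm_nonneg _) (ContinuousLinearMap.norm_snd_le _ _ _)).trans
        (abs_derivTerm_le 1 f n hq.1 hq.2)
  · refine summable_of_ne_finset_zero (s := {0}) fun n hn => ?_
    have : n 0 ≠ 0 ∨ n 1 ≠ 0 := by
      by_contra! h
      exact hn (Finset.mem_singleton.2 (Finsupp.ext fun i => by fin_cases i; exacts [h.1, h.2]))
    rcases this with h | h <;> simp [h]

section Rep

variable {F : ℝ × ℝ → ℝ} {f : DoubleSeries}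

theorem Rep.pu (hF : Rep F f) : Rep (pu F) (du f) := by
  refine ⟨hF.1.pderiv 0, ?_⟩
  filter_upwards [hF.1.hasFDerivAt, hF.2.eventually_nhds] with q h1 h2
  have h2 : F =ᶠ[𝓝 q] evalAt f := h2
  rw [_root_.pu, h2.fderiv_eq, h1.fderiv]
  simp

theorem Rep.pv (hF : Rep F f) : Rep (pv F) (dv f) := by
  refine ⟨hF.1.pderiv 1, ?_⟩
  filter_upwards [hF.1.hasFDerivAt, hF.2.eventually_nhds] with q h1 h2
  have h2 : F =ᶠ[𝓝 q] evalAt f := h2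
  rw [_root_.pv, h2.fderiv_eq, h1.fderiv]
  simp

theorem tendsto_axis : Tendsto (fun u : ℝ => (u, (0 : ℝ))) (𝓝 0) (𝓝 0) := by
  have : Continuous fun u : ℝ => (u, (0 : ℝ)) := by fun_prop
  exact this.tendsto 0

theorem Conv.coeff_eq_zero_of_axis (k : ℕ) {f : DoubleSeries} (hf : Conv f)
    (h : ∀ᶠ u : ℝ in 𝓝 0, evalAt f (u, 0) = 0) : coeff (single 0 k) f = 0 := by
  induction k generalizing f with
  | zero =>
    rw [single_zero, ← evalAt_zero]
    exact h.self_of_nhds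
  | succ k ih =>
    have := ih (hf.pderiv 0) (f := du f) ?_
    · rw [coeff_pderiv, ← single_add] at this
      refine (mul_eq_zero.1 this).resolve_right ?_
      positivity
    · filter_upwards [tendsto_axis.eventually hf.hasFDerivAt, h.eventually_nhds] with u h1 h2
      have h3 := h1.comp_hasDerivAt u ((hasDerivAt_id u).prodMk (hasDerivAt_const u (0 : ℝ)))
      have h4 : HasDerivAt (fun _ : ℝ => (0 : ℝ)) _ u := h3.congr_of_eventuallyEq
        (h2.mono fun t ht => ht.symm)
      simpa using h4.unique (hasDerivAt_const u 0)

theorem Rep.X_dvd (hF : Rep F f) (h : ∀ᶠ u : ℝ in 𝓝 0, F (u, 0) = 0) :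
    (X 1 : DoubleSeries) ∣ f := by
  rw [X_dvd_iff]
  intro n hn
  have : n = single 0 (n 0) := by
    ext i
    fin_cases i <;> simp [hn]
  rw [this]
  refine hF.1.coeff_eq_zero_of_axis _ ?_
  filter_upwards [h, tendsto_axis.eventually hF.2] with u h1 h2
  rw [← h2, h1]

theorem Rep.eq_zero (hF : Rep F f) (h : F =ᶠ[𝓝 0] 0) : f = 0 := by
  have key : ∀ k (n : Fin 2 →₀ ℕ) (F : ℝ × ℝ → ℝ) (f : DoubleSeries), n 1 = k → Rep F f →
      F =ᶠ[𝓝 0] 0 → coeff n f = 0 := by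
    intro k
    induction k with
    | zero => exact fun n F f hn hF h => X_dvd_iff.1 (hF.X_dvd (tendsto_axis.eventually h)) n hn
    | succ k ih =>
      intro n F f hn hF h
      obtain ⟨m, rfl⟩ := exists_eq_add_single (n := n) (i := 1) (by omega)
      have := ih m _ _ (by simpa using hn) hF.pv ?_
      · rw [coeff_pderiv] at this
        exact (mul_eq_zero.1 this).resolve_right (by positivity)
      · filter_upwards [h.eventually_nhds] with q hq
        have : F =ᶠ[𝓝 q] fun _ => 0 := hq
        simp [_root_.pv, this.fderiv_eq]
  ext n
  exact key _ n F f rfl hF h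

theorem Rep.unique {G : ℝ × ℝ → ℝ} {g : DoubleSeries} (hF : Rep F f) (hG : Rep G g)
    (h : F =ᶠ[𝓝 0] G) : f = g :=
  sub_eq_zero.1 <| (hF.sub hG).eq_zero <| h.mono fun q hq => by simp [hq]

end Rep

/-- Exponents as pairs of natural numbers. -/
def pairEquiv : ℕ × ℕ ≃ (Fin 2 →₀ ℕ) :=
  (finTwoArrowEquiv ℕ).symm.trans Finsupp.equivFunOnFinite.symm

@[simp] theorem pairEquiv_apply_zero (x : ℕ × ℕ) : pairEquiv x 0 = x.1 := rfl

@[simp] theorem pairEquiv_apply_one (x : ℕ × ℕ) : pairEquiv x 1 = x.2 := rfl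

/-- Exponents sorted by total degree. -/
def degreeEquiv : (Σ n : ℕ, Finset.HasAntidiagonal.antidiagonal n) ≃ (Fin 2 →₀ ℕ) :=
  Finset.HasAntidiagonal.sigmaAntidiagonalEquivProd.trans pairEquiv

theorem degreeEquiv_apply (x : Σ n : ℕ, Finset.HasAntidiagonal.antidiagonal n) :
    degreeEquiv x = pairEquiv x.2 := rfl

theorem hasSum_antidiagonal {a : (Fin 2 →₀ ℕ) → ℝ} {s : ℝ} (h : HasSum a s) :
    HasSum (fun n : ℕ => ∑ x ∈ Finset.HasAntidiagonal.antidiagonal n, a (pairEquiv x)) s := by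
  have h1 := (degreeEquiv.hasSum_iff.2 h).sigma fun n => hasSum_fintype _
  convert h1 using 2 with n
  rw [← Finset.sum_coe_sort]
  rfl

theorem summable_of_antidiagonal {a : (Fin 2 →₀ ℕ) → ℝ} (h0 : ∀ n, 0 ≤ a n)
    (h : Summable fun n : ℕ => ∑ x ∈ Finset.HasAntidiagonal.antidiagonal n, a (pairEquiv x)) :
    Summable a := by
  rw [← degreeEquiv.summable_iff]
  refine (summable_sigma_of_nonneg fun x => h0 _).2 ?_
  refine ⟨fun n => Summable.of_finite, ?_⟩
  refine h.congr fun n => ?_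
  rw [tsum_fintype, ← Finset.sum_coe_sort]
  rfl

/-- The multilinear map whose diagonal is the monomial `u ^ k * v ^ (n - k)`. -/
def monomialMap (n k : ℕ) : (ℝ × ℝ) [×n]→L[ℝ] ℝ :=
  (ContinuousMultilinearMap.mkPiAlgebraFin ℝ n ℝ).compContinuousLinearMap fun i =>
    if (i : ℕ) < k then ContinuousLinearMap.fst ℝ ℝ ℝ else ContinuousLinearMap.snd ℝ ℝ ℝ

theorem monomialMap_diag {n : ℕ} {x : ℕ × ℕ} (hx : x ∈ Finset.HasAntidiagonal.antidiagonal n)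
    (q : ℝ × ℝ) : monomialMap n x.1 (fun _ => q) = q.1 ^ x.1 * q.2 ^ x.2 := by
  rw [Finset.HasAntidiagonal.mem_antidiagonal] at hx
  subst hx
  rw [monomialMap, ContinuousMultilinearMap.compContinuousLinearMap_apply,
    ContinuousMultilinearMap.mkPiAlgebraFin_apply, List.prod_ofFn, Fin.prod_univ_add]
  simp

theorem norm_monomialMap_le (n k : ℕ) : ‖monomialMap n k‖ ≤ 1 := by
  refine (ContinuousMultilinearMap.norm_compContinuousLinearMap_le _ _).trans ?_
  rw [ContinuousMultilinearMap.norm_mkPiAlgebraFin, one_mul]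
  refine Finset.prod_le_one (fun _ _ => norm_nonneg _) fun i _ => ?_
  split_ifs
  · exact ContinuousLinearMap.norm_fst_le _ _ _
  · exact ContinuousLinearMap.norm_snd_le _ _ _

/-- The formal multilinear series of a double series. -/
def toFormal (f : DoubleSeries) : FormalMultilinearSeries ℝ (ℝ × ℝ) ℝ := fun n =>
  ∑ x ∈ Finset.HasAntidiagonal.antidiagonal n, coeff (pairEquiv x) f • monomialMap n x.1

theorem toFormal_diag (f : DoubleSeries) (n : ℕ) (q : ℝ × ℝ) :
    toFormal f n (fun _ => q) = ∑ x ∈ Finset.HasAntidiagonal.antidiagonal n,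
      coeff (pairEquiv x) f * (q.1 ^ x.1 * q.2 ^ x.2) := by
  rw [show toFormal f n = ∑ x ∈ Finset.HasAntidiagonal.antidiagonal n,
    coeff (pairEquiv x) f • monomialMap n x.1 from rfl, _root_.sum_apply]
  refine Finset.sum_congr rfl fun x hx => ?_
  rw [_root_.smul_apply, monomialMap_diag hx, smul_eq_mul]

theorem NormLE.hasFPowerSeriesOnBall {ρ c : ℝ} {f : DoubleSeries} (hρ : 0 < ρ)
    (hf : NormLE (polyWeight ρ) f c) :
    HasFPowerSeriesOnBall (evalAt f) (toFormal f) 0 (ENNReal.ofReal ρ) where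
  r_le := by
    have h1 := hasSum_antidiagonal (hf.summable (isWeight_polyWeight hρ)).hasSum
    refine FormalMultilinearSeries.le_radius_of_summable _
      (Summable.of_nonneg_of_le (fun n => by positivity) (fun n => ?_) h1.summable)
    rw [Real.coe_toNNReal _ hρ.le]
    refine (mul_le_mul_of_nonneg_right (norm_sum_le _ _) (by positivity)).trans ?_
    rw [Finset.sum_mul]
    refine Finset.sum_le_sum fun x hx => ?_
    rw [Finset.HasAntidiagonal.mem_antidiagonal] at hx
    rw [polyWeight, pairEquiv_apply_zero, pairEquiv_apply_one, hx, norm_smul, Real.norm_eq_abs]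
    refine mul_le_mul_of_nonneg_right ?_ (by positivity)
    exact mul_le_of_le_one_right (abs_nonneg _) (norm_monomialMap_le _ _)
  r_pos := by simpa using hρ
  hasSum := by
    intro q hq
    have hq' : ‖q‖ < ρ := by
      rw [mem_eball_zero_iff, ← ofReal_norm, ENNReal.ofReal_lt_ofReal_iff hρ] at hq
      exact hq
    rw [zero_add]
    have h1 := hasSum_antidiagonal
      (hf.hasSum hρ ((norm_fst_le q).trans hq'.le) ((norm_snd_le q).trans hq'.le))
    simp only [pairEquiv_apply_zero, pairEquiv_apply_one, ← toFormal_diag] at h1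
    exact h1

theorem Rep.analyticAt {F : ℝ × ℝ → ℝ} {f : DoubleSeries} (hF : Rep F f) : AnalyticAt ℝ F 0 := by
  obtain ⟨⟨ρ, hρ, c, hc⟩, h⟩ := hF
  exact (hc.hasFPowerSeriesOnBall hρ).analyticAt.congr h.symm

theorem sum_antidiagonal_powersetCard {n : ℕ} (g : Finset (Fin n) → ℝ) :
    ∑ x ∈ Finset.HasAntidiagonal.antidiagonal n, ∑ s ∈ Finset.powersetCard x.1 Finset.univ, g s =
      ∑ s, g s := by
  rw [Finset.Nat.sum_antidiagonal_eq_sum_range_succ_mk, ← Finset.powerset_univ,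
    Finset.sum_powerset, Finset.card_univ, Fintype.card_fin]

/-- The multilinear form `p n` evaluated at `(1, 0)` in the slots `s` and `(0, 1)` elsewhere. -/
def slotCoeff (p : FormalMultilinearSeries ℝ (ℝ × ℝ) ℝ) (n : ℕ) (s : Finset (Fin n)) : ℝ :=
  p n (s.piecewise (fun _ => (1, 0)) fun _ => (0, 1))

/-- The double series of a formal multilinear series. -/
def ofFormal (p : FormalMultilinearSeries ℝ (ℝ × ℝ) ℝ) : DoubleSeries := fun m =>
  ∑ s ∈ Finset.powersetCard (m 0) Finset.univ, slotCoeff p (m 0 + m 1) s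

theorem coeff_ofFormal (p : FormalMultilinearSeries ℝ (ℝ × ℝ) ℝ) {n : ℕ} {x : ℕ × ℕ}
    (hx : x ∈ Finset.HasAntidiagonal.antidiagonal n) : coeff (pairEquiv x) (ofFormal p) =
      ∑ s ∈ Finset.powersetCard x.1 Finset.univ, slotCoeff p n s := by
  rw [Finset.HasAntidiagonal.mem_antidiagonal] at hx
  subst hx
  rfl

theorem sum_coeff_ofFormal (p : FormalMultilinearSeries ℝ (ℝ × ℝ) ℝ) (n : ℕ) (q : ℝ × ℝ) :
    ∑ x ∈ Finset.HasAntidiagonal.antidiagonal n,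
      coeff (pairEquiv x) (ofFormal p) * (q.1 ^ x.1 * q.2 ^ x.2) = p n fun _ => q := by
  have hq : (fun _ : Fin n => q) =
      (fun _ : Fin n => q.1 • ((1, 0) : ℝ × ℝ)) + fun _ => q.2 • ((0, 1) : ℝ × ℝ) := by
    funext i
    simp
  have hs : ∀ s : Finset (Fin n), p n (s.piecewise (fun _ => q.1 • ((1, 0) : ℝ × ℝ))
      fun _ => q.2 • ((0, 1) : ℝ × ℝ)) = slotCoeff p n s * (q.1 ^ s.card * q.2 ^ (n - s.card)) := by
    intro s
    have : (s.piecewise (fun _ => q.1 • ((1, 0) : ℝ × ℝ)) fun _ => q.2 • ((0, 1) : ℝ × ℝ)) =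
        fun i => s.piecewise (fun _ => q.1) (fun _ => q.2) i •
          s.piecewise (fun _ => ((1, 0) : ℝ × ℝ)) (fun _ => (0, 1)) i := by
      funext i
      by_cases hi : i ∈ s <;> simp [hi]
    rw [this, ContinuousMultilinearMap.map_smul_univ, slotCoeff, smul_eq_mul, mul_comm,
      Finset.prod_piecewise]
    simp [Finset.card_sdiff]
  rw [hq, ContinuousMultilinearMap.map_add_univ, Finset.sum_congr rfl fun s _ => hs s,
    ← sum_antidiagonal_powersetCard]
  refine Finset.sum_congr rfl fun x hx => ?_
  rw [coeff_ofFormal p hx, Finset.sum_mul]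
  refine Finset.sum_congr rfl fun s h => ?_
  rw [Finset.HasAntidiagonal.mem_antidiagonal] at hx
  rw [(Finset.mem_powersetCard.1 h).2, Nat.sub_eq_of_eq_add' hx.symm]

theorem abs_slotCoeff_le (p : FormalMultilinearSeries ℝ (ℝ × ℝ) ℝ) (n : ℕ) (s : Finset (Fin n)) :
    |slotCoeff p n s| ≤ ‖p n‖ := by
  refine ((p n).le_opNorm _).trans (mul_le_of_le_one_right (norm_nonneg _) ?_)
  refine Finset.prod_le_one (fun _ _ => norm_nonneg _) fun i _ => ?_
  by_cases hi : i ∈ s <;> simp [hi]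

theorem sum_abs_coeff_ofFormal_le (p : FormalMultilinearSeries ℝ (ℝ × ℝ) ℝ) (n : ℕ) :
    ∑ x ∈ Finset.HasAntidiagonal.antidiagonal n, |coeff (pairEquiv x) (ofFormal p)| ≤
      2 ^ n * ‖p n‖ := by
  calc _ ≤ ∑ x ∈ Finset.HasAntidiagonal.antidiagonal n,
        ∑ s ∈ Finset.powersetCard x.1 Finset.univ, |slotCoeff p n s| :=
        Finset.sum_le_sum fun x hx => by
          rw [coeff_ofFormal p hx]
          exact Finset.abs_sum_le_sum_abs _ _
    _ = ∑ s, |slotCoeff p n s| := sum_antidiagonal_powersetCard _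
    _ ≤ ∑ _s : Finset (Fin n), ‖p n‖ := Finset.sum_le_sum fun s _ => abs_slotCoeff_le p n s
    _ = 2 ^ n * ‖p n‖ := by simp

theorem exists_rep {F : ℝ × ℝ → ℝ} (hF : AnalyticAt ℝ F 0) : ∃ f, Rep F f := by
  obtain ⟨p, r, hp⟩ := hF
  obtain ⟨ρ, hρ, hρr⟩ : ∃ ρ : ℝ≥0, 0 < ρ ∧ ((2 * ρ : ℝ≥0) : ℝ≥0∞) < r := by
    obtain ⟨t, ht0, ht⟩ := ENNReal.lt_iff_exists_nnreal_btwn.1 hp.r_pos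
    refine ⟨t / 2, by simpa using ht0, ?_⟩
    rwa [mul_div_cancel₀ _ two_ne_zero]
  have hρ' : (0 : ℝ) < ρ := hρ
  have hsum := p.summable_norm_mul_pow (hρr.trans_le hp.r_le)
  have hnorm : Summable fun n => |coeff n (ofFormal p)| * polyWeight ρ n := by
    refine summable_of_antidiagonal
      (fun n => mul_nonneg (abs_nonneg _) ((isWeight_polyWeight hρ').pos n).le) ?_
    refine Summable.of_nonneg_of_le (fun n => Finset.sum_nonneg fun x _ =>
      mul_nonneg (abs_nonneg _) ((isWeight_polyWeight hρ').pos _).le) (fun n => ?_) hsum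
    have := mul_le_mul_of_nonneg_right (sum_abs_coeff_ofFormal_le p n) (pow_nonneg hρ'.le n)
    rw [Finset.sum_mul] at this
    refine (Finset.sum_congr rfl fun x hx => ?_).trans_le (this.trans_eq ?_)
    · rw [Finset.HasAntidiagonal.mem_antidiagonal] at hx
      rw [polyWeight, pairEquiv_apply_zero, pairEquiv_apply_one, hx]
    · push_cast
      ring
  have hc := NormLE.of_summable (isWeight_polyWeight hρ') hnorm
  refine ⟨ofFormal p, ⟨ρ, hρ', _, hc⟩, ?_⟩
  filter_upwards [eventually_abs_le hρ', Metric.eball_mem_nhds (0 : ℝ × ℝ) hp.r_pos] with q h1 h2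
  have h3 := hp.hasSum h2
  rw [zero_add] at h3
  have h4 := hasSum_antidiagonal (hc.hasSum hρ' h1.1 h1.2)
  simp only [pairEquiv_apply_zero, pairEquiv_apply_one, sum_coeff_ofFormal] at h4
  exact h3.unique h4

theorem conv_X (i : Fin 2) : Conv (X i) := by
  classical
  refine ⟨1, one_pos, _, NormLE.of_summable (isWeight_polyWeight one_pos) ?_⟩
  refine summable_of_ne_finset_zero (s := {single i 1}) fun n hn => ?_
  rw [coeff_X, if_neg (by simpa using hn)]
  simp

theorem Conv.add {f g : DoubleSeries} (hf : Conv f) (hg : Conv g) : Conv (f + g) :=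
  (hf.rep.add hg.rep).1

theorem Conv.neg {f : DoubleSeries} (hf : Conv f) : Conv (-f) := hf.rep.neg.1

theorem Conv.mul {f g : DoubleSeries} (hf : Conv f) (hg : Conv g) : Conv (f * g) :=
  (hf.rep.mul hg.rep).1

theorem eq_zero_of_dv_dv {f : DoubleSeries} (h : dv (dv f) = 0)
    (h1 : (X 1 : DoubleSeries) ∣ dv f) (h0 : (X 1 : DoubleSeries) ∣ f) : f = 0 :=
  eq_zero_of_dv (eq_zero_of_dv h h1) h0

/-- The second order equations for `f` propagate the first fundamental form off the axis. -/
theorem fundamentalForm_of_equations {E G k : DoubleSeries} {f : Fin 3 → DoubleSeries}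
    (hk : 2 * k = 1) (hku : du k = 0)
    (h1 : fmink (fun a => dv (dv (f a))) (fun a => du (f a)) = -(k * du G))
    (h2 : fmink (fun a => dv (dv (f a))) (fun a => dv (f a)) = k * dv G)
    (h3 : fmink (fun a => dv (dv (f a))) (fun a => du (du (f a))) =
      fmink (fun a => du (dv (f a))) (fun a => du (dv (f a))) + -(k * (dv (dv E) + du (du G))))
    (h01 : (X 1 : DoubleSeries) ∣ fmink (fun a => du (f a)) (fun a => du (f a)) - E)
    (h02 : (X 1 : DoubleSeries) ∣ 2 * fmink (fun a => du (du (f a))) (fun a => dv (f a)) + dv E)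
    (h03 : (X 1 : DoubleSeries) ∣ fmink (fun a => du (f a)) (fun a => dv (f a)))
    (h04 : (X 1 : DoubleSeries) ∣ fmink (fun a => dv (f a)) (fun a => dv (f a)) - G) :
    fmink (fun a => du (f a)) (fun a => du (f a)) = E ∧
      fmink (fun a => du (f a)) (fun a => dv (f a)) = 0 ∧
      fmink (fun a => dv (f a)) (fun a => dv (f a)) = G := by
  have hZ : fmink (fun a => dv (f a)) (fun a => dv (f a)) - G = 0 := by
    refine eq_zero_of_dv ?_ h04
    simp only [fmink, map_add, map_sub, Derivation.leibniz, smul_eq_mul] at h2 ⊢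
    linear_combination 2 * h2 + dv G * hk
  have hZu := congrArg du hZ
  have hY : fmink (fun a => du (f a)) (fun a => dv (f a)) = 0 := by
    refine eq_zero_of_dv ?_ h03
    simp only [fmink, map_add, map_sub, Derivation.leibniz, smul_eq_mul, map_zero] at h1 hZu ⊢
    simp only [du_dv] at h1 hZu ⊢
    linear_combination h1 + k * hZu -
      (dv (f 0) * dv (du (f 0)) + dv (f 1) * dv (du (f 1)) - dv (f 2) * dv (du (f 2))) * hk
  refine ⟨?_, hY, sub_eq_zero.1 hZ⟩
  have hYu := congrArg du hY
  have h1u := congrArg du h1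
  refine sub_eq_zero.1 (eq_zero_of_dv_dv ?_ ?_ h01)
  · simp only [fmink, map_add, map_sub, map_neg, Derivation.leibniz, smul_eq_mul, hku, du_dv]
      at h1u h3 ⊢
    linear_combination 2 * h1u - 2 * h3 + (dv (dv E)) * hk
  · obtain ⟨w, hw⟩ := h02
    refine ⟨-w, ?_⟩
    simp only [fmink, map_add, map_sub, Derivation.leibniz, smul_eq_mul, map_zero, du_dv]
      at hw hYu ⊢
    linear_combination 2 * hYu - hw

theorem X_dvd_iff_mk {f : DoubleSeries} : (X 1 : DoubleSeries) ∣ f ↔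
    Ideal.Quotient.mk (Ideal.span {(X 1 : DoubleSeries)}) f = 0 := by
  rw [Ideal.Quotient.eq_zero_iff_mem, Ideal.mem_span_singleton]

/-- Formal isometric realization, given formal initial data along the axis `v = 0`. -/
theorem exists_formal_isometry {E G s c e b : DoubleSeries} (hE : Conv E) (hG : Conv G)
    (hs : Conv s) (hc : Conv c) (he : Conv e) (hb : Conv b)
    (dus : du s = c) (duc : du c = -s) (dvs : dv s = 0) (dvc : dv c = 0) (dve : dv e = 0)
    (dvb : dv b = 0) (hcs : c * c + s * s = 1) (s0 : coeff 0 s = 0) (c0 : coeff 0 c = 1)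
    (b0 : coeff 0 b ≠ 0) (hE1 : (X 1 : DoubleSeries) ∣ E - 1)
    (hEe : (X 1 : DoubleSeries) ∣ 2 * e + dv E)
    (hGb : (X 1 : DoubleSeries) ∣ b * b - (e * e - G)) :
    ∃ f : Fin 3 → DoubleSeries, (∀ a, Conv (f a)) ∧
      fmink (fun a => du (f a)) (fun a => du (f a)) = E ∧
      fmink (fun a => du (f a)) (fun a => dv (f a)) = 0 ∧
      fmink (fun a => dv (f a)) (fun a => dv (f a)) = G ∧
      coeff 0 (du (f 0) * dv (f 2) - du (f 2) * dv (f 0)) ≠ 0 := by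
  obtain ⟨k, hk⟩ : ∃ k : DoubleSeries, k = C (1 / 2) := ⟨_, rfl⟩
  have hkc : Conv k := hk ▸ conv_C _
  have hku : du k = 0 := hk ▸ pderiv_C
  have hk2 : 2 * k = 1 := by
    rw [hk, show (2 : DoubleSeries) = C 2 from (map_ofNat C 2).symm, ← map_mul]
    norm_num
  obtain ⟨x, hx⟩ : ∃ x : DoubleSeries, x = X 1 := ⟨_, rfl⟩
  have hxc : Conv x := hx ▸ conv_X 1
  have dux : du x = 0 := hx ▸ pderiv_X_of_ne (by decide)
  have dvx : dv x = 1 := hx ▸ pderiv_X_self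
  have x0 : constantCoeff x = 0 := by rw [hx, constantCoeff_X]
  rw [coeff_zero_eq_constantCoeff_apply] at s0 c0 b0
  obtain ⟨A, hA⟩ : ∃ A : Fin 3 → DoubleSeries,
    A = ![s - x * (s * e), -c + x * (c * e), x * b] := ⟨_, rfl⟩
  have A0 : A 0 = s - x * (s * e) := by rw [hA]; rfl
  have A1 : A 1 = -c + x * (c * e) := by rw [hA]; rfl
  have A2 : A 2 = x * b := by rw [hA]; rfl
  obtain ⟨β, hβ⟩ : ∃ β : Fin 3 → DoubleSeries,
    β = ![-(k * du G), k * dv G, -(k * (dv (dv E) + du (du G)))] := ⟨_, rfl⟩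
  have hAc : ∀ a, Conv (A a) := by
    rw [Fin.forall_fin_succ, Fin.forall_fin_succ, Fin.forall_fin_one]
    refine ⟨?_, ?_, ?_⟩
    · exact A0 ▸ hs.sub (hxc.mul (hs.mul he))
    · exact A1 ▸ hc.neg.add (hxc.mul (hc.mul he))
    · exact A2 ▸ hxc.mul hb
  have hβc : ∀ a, Conv (β a) := by
    rw [Fin.forall_fin_succ, Fin.forall_fin_succ, Fin.forall_fin_one, hβ]
    exact ⟨(hkc.mul (hG.pderiv 0)).neg, hkc.mul (hG.pderiv 1),
      (hkc.mul (((hE.pderiv 1).pderiv 1).add ((hG.pderiv 0).pderiv 0))).neg⟩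
  have hAu : ∀ a, coeff 0 (du (A a)) = (![1, 0, 0] : Fin 3 → ℝ) a := by
    simp only [Fin.forall_fin_succ, coeff_zero_eq_constantCoeff_apply]
    refine ⟨?_, ?_, ?_⟩
    · simp [A0, dux, dus, x0, c0]
    · simp [A1, dux, duc, x0, s0]
    · simp [A2, dux, x0]
  have hAv : ∀ a, coeff 0 (dv (A a)) =
      (![0, constantCoeff e, constantCoeff b] : Fin 3 → ℝ) a := by
    simp only [Fin.forall_fin_succ, coeff_zero_eq_constantCoeff_apply]
    refine ⟨?_, ?_, ?_⟩
    · simp [A0, dvs, dve, dvx, s0]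
    · simp [A1, dvc, dve, dvx, c0]
    · simp [A2, dvb, dvx]
  have hAuu : ∀ a, coeff 0 (du (du (A a))) = (![0, 1, 0] : Fin 3 → ℝ) a := by
    simp only [Fin.forall_fin_succ, coeff_zero_eq_constantCoeff_apply]
    refine ⟨?_, ?_, ?_⟩
    · simp [A0, dux, dus, duc, x0, s0]
    · simp [A1, dux, duc, dus, x0, c0]
    · simp [A2, dux, x0]
  obtain ⟨h, f, hf, hfA, e1, e2, e3⟩ :=
    exists_solution A β (constantCoeff e) (constantCoeff b) b0 hAc hβc hAu hAv hAuu
  have hdvdvA : ∀ a, dv (dv (A a)) = 0 := by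
    rw [Fin.forall_fin_succ, Fin.forall_fin_succ, Fin.forall_fin_one]
    refine ⟨?_, ?_, ?_⟩
    · simp [A0, dvs, dve, dvx]
    · simp [A1, dvc, dve, dvx]
    · simp [A2, dvb, dvx]
  have hh : h = fun a => dv (dv (f a)) := by
    funext a
    rw [hfA, map_add, map_add, hdvdvA, dv_vint, dv_vint, zero_add]
  have mk_vint : ∀ g, Ideal.Quotient.mk (Ideal.span {(X 1 : DoubleSeries)}) (vint g) = 0 :=
    fun g => X_dvd_iff_mk.1 (X_dvd_vint g)
  have mk_x : Ideal.Quotient.mk (Ideal.span {(X 1 : DoubleSeries)}) x = 0 :=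
    X_dvd_iff_mk.1 (hx ▸ dvd_rfl)
  rw [X_dvd_iff_mk] at hE1 hEe hGb
  obtain ⟨π, hπ⟩ : ∃ π, π = Ideal.Quotient.mk (Ideal.span {(X 1 : DoubleSeries)}) := ⟨_, rfl⟩
  rw [← hπ] at mk_vint mk_x hE1 hEe hGb
  have hcs' := congrArg π hcs
  simp only [map_add, map_sub, map_mul, map_one, map_ofNat] at hE1 hEe hGb hcs'
  have mu : ∀ a, π (du (f a)) = π (du (A a)) := fun a => by
    rw [hfA, map_add, du_vint, map_add, mk_vint, add_zero]
  have mv : ∀ a, π (dv (f a)) = π (dv (A a)) := fun a => by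
    rw [hfA, map_add, dv_vint, map_add, mk_vint, add_zero]
  have muu : ∀ a, π (du (du (f a))) = π (du (du (A a))) := fun a => by
    rw [hfA, map_add, map_add, du_vint, du_vint, map_add, mk_vint, add_zero]
  have mv0 : π (dv (A 0)) = -(π s * π e) := by simp [A0, dvs, dve, dvx]
  have mv1 : π (dv (A 1)) = π c * π e := by simp [A1, dvc, dve, dvx]
  have mv2 : π (dv (A 2)) = π b := by simp [A2, dvb, dvx]
  have mu0 : π (du (A 0)) = π c := by simp [A0, dus, dux, mk_x]
  have mu1 : π (du (A 1)) = π s := by simp [A1, duc, dux, mk_x]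
  have mu2 : π (du (A 2)) = 0 := by simp [A2, dux, mk_x]
  have muu0 : π (du (du (A 0))) = -π s := by simp [A0, dus, duc, dux, mk_x]
  have muu1 : π (du (du (A 1))) = π c := by simp [A1, dus, duc, dux, mk_x]
  have muu2 : π (du (du (A 2))) = 0 := by simp [A2, dux, mk_x]
  rw [hh, hβ] at e1 e2 e3
  obtain ⟨r1, r2, r3⟩ := fundamentalForm_of_equations hk2 hku e1 e2 e3
    (by
      rw [X_dvd_iff_mk, ← hπ]
      simp only [fmink, map_add, map_sub, map_mul, mu, mu0, mu1, mu2]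
      linear_combination hcs' - hE1)
    (by
      rw [X_dvd_iff_mk, ← hπ]
      simp only [fmink, map_add, map_sub, map_mul, map_ofNat, muu, mv, muu0, muu1, muu2,
        mv0, mv1, mv2]
      linear_combination hEe + 2 * π e * hcs')
    (by
      rw [X_dvd_iff_mk, ← hπ]
      simp only [fmink, map_add, map_sub, map_mul, mu, mv, mu0, mu1, mu2, mv0, mv1, mv2]
      ring)
    (by
      rw [X_dvd_iff_mk, ← hπ]
      simp only [fmink, map_add, map_sub, map_mul, mv, mv0, mv1, mv2]
      linear_combination π e * π e * hcs' - hGb)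
  refine ⟨f, hf, r1, r2, r3, ?_⟩
  have vint0 : ∀ g, coeff 0 (vint g) = 0 := fun g => coeff_vint_of_eq_zero g rfl
  have cu : ∀ a, constantCoeff (du (f a)) = (![1, 0, 0] : Fin 3 → ℝ) a := fun a => by
    rw [← hAu a, ← coeff_zero_eq_constantCoeff_apply, hfA, map_add, du_vint, map_add, vint0,
      add_zero]
  have cv : ∀ a, constantCoeff (dv (f a)) =
      (![0, constantCoeff e, constantCoeff b] : Fin 3 → ℝ) a := fun a => by
    rw [← hAv a, ← coeff_zero_eq_constantCoeff_apply, hfA, map_add, dv_vint, map_add, vint0,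
      add_zero]
  rw [coeff_zero_eq_constantCoeff_apply, map_sub, map_mul, map_mul, cu, cu, cv, cv]
  simpa using b0

theorem pu_comp_fst {φ : ℝ → ℝ} {q : ℝ × ℝ} (h : DifferentiableAt ℝ φ q.1) :
    pu (fun q : ℝ × ℝ => φ q.1) q = deriv φ q.1 := by
  have := h.hasDerivAt.hasFDerivAt.comp q (hasFDerivAt_fst (𝕜 := ℝ) (p := q))
  rw [pu, show (fun q : ℝ × ℝ => φ q.1) = φ ∘ Prod.fst from rfl, this.fderiv]
  simp

theorem pv_comp_fst {φ : ℝ → ℝ} {q : ℝ × ℝ} (h : DifferentiableAt ℝ φ q.1) :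
    pv (fun q : ℝ × ℝ => φ q.1) q = 0 := by
  have := h.hasDerivAt.hasFDerivAt.comp q (hasFDerivAt_fst (𝕜 := ℝ) (p := q))
  rw [pv, show (fun q : ℝ × ℝ => φ q.1) = φ ∘ Prod.fst from rfl, this.fderiv]
  simp

theorem tendsto_fst_zero : Tendsto (fun q : ℝ × ℝ => q.1) (𝓝 0) (𝓝 0) :=
  continuous_fst.tendsto (0 : ℝ × ℝ)

theorem exists_rep_comp_fst {φ : ℝ → ℝ} (h : AnalyticAt ℝ φ 0) :
    ∃ f, Rep (fun q => φ q.1) f ∧ Rep (fun q => deriv φ q.1) (du f) ∧ dv f = 0 := by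
  have h1 : AnalyticAt ℝ (fun q : ℝ × ℝ => φ q.1) 0 :=
    AnalyticAt.comp (f := Prod.fst) (x := (0 : ℝ × ℝ)) h analyticAt_fst
  obtain ⟨f, hf⟩ := exists_rep h1
  have hd := tendsto_fst_zero.eventually h.eventually_analyticAt
  refine ⟨f, hf, hf.pu.congr ?_, hf.pv.eq_zero ?_⟩
  · filter_upwards [hd] with q hq using (pu_comp_fst hq.differentiableAt).symm
  · filter_upwards [hd] with q hq using pv_comp_fst hq.differentiableAt

theorem analyticAt_axis {F : ℝ × ℝ → ℝ} (h : AnalyticAt ℝ F 0) :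
    AnalyticAt ℝ (fun t : ℝ => F (t, 0)) 0 :=
  AnalyticAt.comp (f := fun t : ℝ => (t, (0 : ℝ))) (x := (0 : ℝ)) h
    (analyticAt_id.prod analyticAt_const)

theorem exists_isometric_series {E G : ℝ × ℝ → ℝ} {E' G' : DoubleSeries} (hE : Rep E E')
    (hG : Rep G G') (hE1 : ∀ᶠ u : ℝ in 𝓝 0, E (u, 0) = 1) (hG0 : G 0 = 0)
    (hEv : pv E 0 ≠ 0) : ∃ f : Fin 3 → DoubleSeries, (∀ a, Conv (f a)) ∧
      fmink (fun a => du (f a)) (fun a => du (f a)) = E' ∧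
      fmink (fun a => du (f a)) (fun a => dv (f a)) = 0 ∧
      fmink (fun a => dv (f a)) (fun a => dv (f a)) = G' ∧
      coeff 0 (du (f 0) * dv (f 2) - du (f 2) * dv (f 0)) ≠ 0 := by
  obtain ⟨s, hs, hsu, hsv⟩ := exists_rep_comp_fst (φ := Real.sin) Real.analyticAt_sin
  obtain ⟨c, hc, hcu, hcv⟩ := exists_rep_comp_fst (φ := Real.cos) Real.analyticAt_cos
  obtain ⟨φ, hφ⟩ : ∃ φ : ℝ → ℝ, φ = fun t => -(pv E (t, 0)) / 2 := ⟨_, rfl⟩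
  have hφa : AnalyticAt ℝ φ 0 := hφ ▸ (analyticAt_axis hE.pv.analyticAt).neg.div_const
  have hφ0 : φ 0 ≠ 0 := by
    rw [hφ]
    exact div_ne_zero (neg_ne_zero.2 hEv) two_ne_zero
  obtain ⟨χ, hχ⟩ : ∃ χ : ℝ → ℝ, χ = fun t => φ t * φ t - G (t, 0) := ⟨_, rfl⟩
  have hχa : AnalyticAt ℝ χ 0 := hχ ▸ (hφa.mul hφa).sub (analyticAt_axis hG.analyticAt)
  have hχ0 : 0 < χ 0 := by
    have : G (0, 0) = 0 := hG0
    rw [hχ]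
    simpa [this] using hφ0
  have hψa : AnalyticAt ℝ (fun t => √(χ t)) 0 :=
    ((Real.contDiffAt_sqrt (n := ⊤) hχ0.ne').comp (0 : ℝ) hχa.contDiffAt).analyticAt
  obtain ⟨e, he, -, hev⟩ := exists_rep_comp_fst hφa
  obtain ⟨b, hb, -, hbv⟩ := exists_rep_comp_fst hψa
  refine exists_formal_isometry hE.1 hG.1 hs.1 hc.1 he.1 hb.1 (hsu.unique hc ?_)
    (hcu.unique hs.neg ?_) hsv hcv hev hbv (((hc.mul hc).add (hs.mul hs)).unique
      (by simpa using rep_C 1) ?_) ?_ ?_ ?_ ((hE.sub (by simpa using rep_C 1)).X_dvd ?_)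
      ((((rep_C 2).mul he).add hE.pv).X_dvd ?_)
      (((hb.mul hb).sub ((he.mul he).sub hG)).X_dvd ?_)
  · exact .of_forall fun q => by simp
  · exact .of_forall fun q => by simp
  · exact .of_forall fun q => by simp [← sq]
  · simp [hs.coeff_zero]
  · simp [hc.coeff_zero]
  · rw [hb.coeff_zero]
    exact (Real.sqrt_pos.2 hχ0).ne'
  · filter_upwards [hE1] with u hu
    simp [hu]
  · refine .of_forall fun u => ?_
    simp only [hφ]
    ring
  · filter_upwards [hχa.continuousAt.eventually_const_lt hχ0] with u hu
    rw [Real.mul_self_sqrt hu.le, hχ, sub_self]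

end DoubleSeries

open DoubleSeries Filter Topology in
/-- Local isometric realization of a real analytic generic mixed
type metric (analogue of the Janet–Cartan theorem): a real analytic generic
mixed type metric `g = E du² + G dv²` in L-coordinates, with the `u`-axis of
generic type I (case I) or a non-null curve through a generic type II
semidefinite point (case II), is locally realized as the first fundamental form
of a real analytic surface in `𝕃³`. -/
theorem janet_cartan_mixed_type
    (U0 : Set (ℝ × ℝ)) (hU0 : IsOpen U0) (h00 : (0, 0) ∈ U0)
    (E G : ℝ × ℝ → ℝ)
    (hEan : AnalyticOnNhd ℝ E U0) (hGan : AnalyticOnNhd ℝ G U0)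
    (hEpos : ∀ q ∈ U0, 0 < E q)
    (hE1 : ∀ u : ℝ, (u, 0) ∈ U0 → E (u, 0) = 1)
    (hEv : pv E (0, 0) ≠ 0)
    (lam : ℝ × ℝ → ℝ) (hlam : lam = fun q => E q * G q)
    (hlam0 : lam (0, 0) = 0)
    (hdlam : fderiv ℝ lam (0, 0) ≠ 0)
    (hcase :
      (∀ u : ℝ, (u, 0) ∈ U0 → G (u, 0) = 0 ∧ pv G (u, 0) ≠ 0) ∨
      (∀ u : ℝ, u ≠ 0 → (u, 0) ∈ U0 → lam (u, 0) ≠ 0)) :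
    ∃ U : Set (ℝ × ℝ), IsOpen U ∧ (0, 0) ∈ U ∧ U ⊆ U0 ∧
    ∃ f : ℝ × ℝ → Fin 3 → ℝ,
      AnalyticOnNhd ℝ f U ∧
      (∀ q ∈ U, LinearIndependent ℝ ![pu f q, pv f q]) ∧
      (∀ q ∈ U,
        mink (pu f q) (pu f q) = E q ∧
        mink (pu f q) (pv f q) = 0 ∧
        mink (pv f q) (pv f q) = G q) := by
  have h00' : U0 ∈ 𝓝 (0 : ℝ × ℝ) := hU0.mem_nhds h00
  obtain ⟨E', hE'⟩ := exists_rep (hEan 0 h00)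
  obtain ⟨G', hG'⟩ := exists_rep (hGan 0 h00)
  have hG0 : G 0 = 0 := by
    rw [hlam] at hlam0
    exact (mul_eq_zero.1 hlam0).resolve_left (hEpos _ h00).ne'
  obtain ⟨f, hf, r1, r2, r3, r4⟩ := exists_isometric_series hE' hG'
    ((tendsto_axis.eventually h00').mono fun u hu => hE1 u hu) hG0 hEv
  have hF : ∀ a, Rep (evalAt (f a)) (f a) := fun a => (hf a).rep
  have hm : ∀ {x y : Fin 3 → DoubleSeries} {X Y : Fin 3 → ℝ × ℝ → ℝ},
      (∀ a, Rep (X a) (x a)) → (∀ a, Rep (Y a) (y a)) →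
      Rep (fun q => mink (fun a => X a q) (fun a => Y a q)) (fmink x y) := fun hX hY =>
    (((hX 0).mul (hY 0)).add ((hX 1).mul (hY 1))).sub ((hX 2).mul (hY 2))
  have m1 := (hm (fun a => (hF a).pu) fun a => (hF a).pu).eventuallyEq (r1 ▸ hE')
  have m2 := (hm (fun a => (hF a).pu) fun a => (hF a).pv).eventuallyEq
    (r2 ▸ (by simpa using rep_C 0 : Rep (fun _ => 0) 0))
  have m3 := (hm (fun a => (hF a).pv) fun a => (hF a).pv).eventuallyEq (r3 ▸ hG')
  have hdet := ((hF 0).pu.mul (hF 2).pv).sub ((hF 2).pu.mul (hF 0).pv)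
  have hdet0 := hdet.analyticAt.continuousAt.eventually_ne (hdet.coeff_zero ▸ r4)
  have han : ∀ᶠ q in 𝓝 (0 : ℝ × ℝ), ∀ a, AnalyticAt ℝ (evalAt (f a)) q :=
    eventually_all.2 fun a => (hF a).analyticAt.eventually_analyticAt
  obtain ⟨U, hU, hUo, h0U⟩ := eventually_nhds_iff.1
    ((((eventually_mem_set.2 h00').and han).and hdet0).and (m1.and (m2.and m3)))
  have hpu : ∀ q ∈ U, pu (fun q a => evalAt (f a) q) q = fun a => pu (evalAt (f a)) q := by
    intro q hq
    funext a
    rw [pu, fderiv_pi fun a => ((hU q hq).1.1.2 a).differentiableAt]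
    rfl
  have hpv : ∀ q ∈ U, pv (fun q a => evalAt (f a) q) q = fun a => pv (evalAt (f a)) q := by
    intro q hq
    funext a
    rw [pv, fderiv_pi fun a => ((hU q hq).1.1.2 a).differentiableAt]
    rfl
  refine ⟨U, hUo, h0U, fun q hq => (hU q hq).1.1.1, fun q a => evalAt (f a) q,
    fun q hq => AnalyticAt.pi fun a => (hU q hq).1.1.2 a, fun q hq => ?_, fun q hq => ?_⟩
  · rw [hpu q hq, hpv q hq, LinearIndependent.pair_iff]
    intro s t hst
    have h0 := congrFun hst 0
    have h2 := congrFun hst 2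
    simp only [Pi.add_apply, Pi.smul_apply, smul_eq_mul, Pi.zero_apply] at h0 h2
    have hd := (hU q hq).1.2
    constructor
    · refine (mul_eq_zero.1 ?_).resolve_right hd
      linear_combination pv (evalAt (f 2)) q * h0 - pv (evalAt (f 0)) q * h2
    · refine (mul_eq_zero.1 ?_).resolve_right hd
      linear_combination pu (evalAt (f 0)) q * h2 - pu (evalAt (f 2)) q * h0
  · rw [hpu q hq, hpv q hq]
    exact (hU q hq).2
end
end
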